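/- (Maurey-type factorization for operators into Schatten p-classes, 0<p<1, core inequality of Theorem 4.3.) Let 0<p<1 and α = 1/p − 1/2. There is a constant C, depending only on p, such that for every n, d, every linear map u : ℂ^d → M_n(ℂ) satisfying ‖u(x)‖_p ≤ ‖x‖ for all x ∈ ℂ^d, and every finite sequence x_1,…,x_N ∈ ℂ^d, there exists a positive definite f ∈ M_n(ℂ) with Tr f = 1 such that ∑_{k=1}^N ‖J(f^{α})^{-1}(u(x_k))‖_2^2 ≤ C ∑_{k=1}^N ‖x_k‖^2. -/

import Mathlib

open scoped BigOperators
open Matrix MeasureTheory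
open scoped ComplexOrder

/-- `A^β` for a Hermitian (in practice positive semidefinite) matrix `A`, via the
spectral functional calculus (with the conventions of `Real.rpow` on eigenvalues,
in particular `0 ^ β = 0` for `β ≠ 0`), extended by `0` to non-Hermitian matrices. -/
noncomputable def posPow {ι : Type*} [Fintype ι] [DecidableEq ι]
    (A : Matrix ι ι ℂ) (β : ℝ) : Matrix ι ι ℂ :=
  if hA : A.IsHermitian then hA.cfc (fun t => t ^ β) else 0

/-- Schatten `p`-(quasi)norm of a complex matrix: `(Tr((A*A)^(p/2)))^(1/p)`. -/
noncomputable def schattenNorm {ι : Type*} [Fintype ι] [DecidableEq ι]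
    (p : ℝ) (A : Matrix ι ι ℂ) : ℝ :=
  ((posPow (Aᴴ * A) (p / 2)).trace.re) ^ (1 / p)

/-- Operator norm of a matrix, acting on the Euclidean space. -/
noncomputable def opNorm {ι : Type*} [Fintype ι] [DecidableEq ι]
    (A : Matrix ι ι ℂ) : ℝ :=
  ‖Matrix.toEuclideanCLM (𝕜 := ℂ) A‖

/-- The quantity `|||x|||_p` for `0 < p ≤ 2`: the infimum of
`‖(∑ aₖ*aₖ)^(1/2)‖_p + ‖(∑ bₖbₖ*)^(1/2)‖_p` over decompositions `xₖ = aₖ + bₖ`. -/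
noncomputable def tripleNorm {n N : ℕ} (p : ℝ)
    (x : Fin N → Matrix (Fin n) (Fin n) ℂ) : ℝ :=
  sInf { r : ℝ | ∃ a b : Fin N → Matrix (Fin n) (Fin n) ℂ,
    (∀ k, x k = a k + b k) ∧
    r = schattenNorm p (posPow (∑ k, (a k)ᴴ * a k) (1/2))
        + schattenNorm p (posPow (∑ k, b k * (b k)ᴴ) (1/2)) }

/-- `E_ε ‖∑ ε_k x_k‖_p ^ p`, the average over a uniformly random choice of signs. -/
noncomputable def radAvg {n N : ℕ} (p : ℝ)
    (x : Fin N → Matrix (Fin n) (Fin n) ℂ) : ℝ :=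
  (1 / 2 ^ N) * ∑ ε : Fin N → Bool,
    (schattenNorm p (∑ k, (if ε k then (1 : ℂ) else -1) • x k)) ^ p

section Powers

open scoped MatrixOrder Matrix.Norms.L2Operator

variable {ι : Type*} [Fintype ι] [DecidableEq ι]

theorem posPow_eq_rpow {f : Matrix ι ι ℂ} (hf : f.PosSemidef) (β : ℝ) : posPow f β = f ^ β := by
  rw [posPow, dif_pos hf.1, ← hf.1.cfc_eq, CFC.rpow_eq_cfc_real (Matrix.nonneg_iff_posSemidef.2 hf)]

theorem posPow_posDef {f : Matrix ι ι ℂ} (hf : f.PosDef) (β : ℝ) : (posPow f β).PosDef := by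
  rw [posPow_eq_rpow hf.posSemidef, ← Matrix.isStrictlyPositive_iff_posDef]
  exact IsStrictlyPositive.rpow f β (Matrix.isStrictlyPositive_iff_posDef.2 hf)

theorem posPow_mul_posPow {f : Matrix ι ι ℂ} (hf : f.PosDef) (a b : ℝ) :
    posPow f a * posPow f b = posPow f (a + b) := by
  simp only [posPow_eq_rpow hf.posSemidef]
  exact (CFC.rpow_add hf.isUnit).symm

theorem posPow_zero {f : Matrix ι ι ℂ} (hf : f.PosDef) : posPow f 0 = 1 := by
  rw [posPow_eq_rpow hf.posSemidef]
  exact CFC.rpow_zero f (Matrix.nonneg_iff_posSemidef.2 hf.posSemidef)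

theorem posPow_one {f : Matrix ι ι ℂ} (hf : f.PosSemidef) : posPow f 1 = f := by
  rw [posPow_eq_rpow hf, CFC.rpow_one f (Matrix.nonneg_iff_posSemidef.2 hf)]

theorem posPow_posPow {f : Matrix ι ι ℂ} (hf : f.PosDef) (a b : ℝ) (ha : a ≠ 0) :
    posPow (posPow f a) b = posPow f (a * b) := by
  rw [posPow_eq_rpow (posPow_posDef hf a).posSemidef]
  simp only [posPow_eq_rpow hf.posSemidef]
  exact CFC.rpow_rpow f a b ha (Matrix.isStrictlyPositive_iff_posDef.2 hf)

theorem posPow_le_posPow {f g : Matrix ι ι ℂ} (hf : f.PosDef) (hg : g.PosDef)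
    (h : (g - f).PosSemidef) {r : ℝ} (hr0 : 0 ≤ r) (hr1 : r ≤ 1) :
    (posPow g r - posPow f r).PosSemidef := by
  simp only [posPow_eq_rpow hf.posSemidef, posPow_eq_rpow hg.posSemidef]
  exact CFC.rpow_le_rpow ⟨hr0, hr1⟩ (Matrix.le_iff.2 h)

theorem posPow_neg_mul_self {f : Matrix ι ι ℂ} (hf : f.PosDef) (a : ℝ) :
    posPow f (-a) * posPow f a = 1 := by
  rw [posPow_mul_posPow hf, neg_add_cancel, posPow_zero hf]

theorem posPow_mul_neg_self {f : Matrix ι ι ℂ} (hf : f.PosDef) (a : ℝ) :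
    posPow f a * posPow f (-a) = 1 := by
  rw [posPow_mul_posPow hf, add_neg_cancel, posPow_zero hf]

theorem posPow_neg_eq_inv {f : Matrix ι ι ℂ} (hf : f.PosDef) (a : ℝ) :
    posPow f (-a) = (posPow f a)⁻¹ :=
  (Matrix.inv_eq_left_inv (posPow_neg_mul_self hf a)).symm

theorem posPow_eq_unitary {f : Matrix ι ι ℂ} (hf : f.IsHermitian) (β : ℝ) :
    posPow f β = (hf.eigenvectorUnitary : Matrix ι ι ℂ) *
      diagonal (fun i => ((hf.eigenvalues i ^ β : ℝ) : ℂ)) *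
        (hf.eigenvectorUnitary : Matrix ι ι ℂ)ᴴ := by
  rw [posPow, dif_pos hf, IsHermitian.cfc, Unitary.conjStarAlgAut_apply]
  rfl

theorem posPow_smul {f : Matrix ι ι ℂ} (hf : f.PosDef) {c : ℝ} (hc : 0 < c) (β : ℝ) :
    posPow ((c : ℂ) • f) β = ((c ^ β : ℝ) : ℂ) • posPow f β := by
  have h1 : (c : ℂ) • f = c • f := by ext; simp
  have h2 : (c • f).PosDef := by
    rw [← h1]; exact hf.smul (by exact_mod_cast hc)
  rw [h1, posPow_eq_rpow h2.posSemidef, posPow_eq_rpow hf.posSemidef,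
    CFC.rpow_eq_cfc_real (Matrix.nonneg_iff_posSemidef.2 h2.posSemidef),
    CFC.rpow_eq_cfc_real (Matrix.nonneg_iff_posSemidef.2 hf.posSemidef)]
  have hsa : IsSelfAdjoint f := hf.1
  have hcont : ∀ (g : ℝ → ℝ), ContinuousOn g (spectrum ℝ f) :=
    fun g => Matrix.finite_real_spectrum.continuousOn g
  have h3 : c • f = cfc (fun x : ℝ => c * x) f := (cfc_const_mul_id c f hsa).symm
  rw [h3]
  refine (cfc_comp' (fun x : ℝ => x ^ β) (fun x : ℝ => c * x) f
    ((Matrix.finite_real_spectrum.image _).continuousOn _) (hcont _) hsa).symm.trans ?_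
  have h4 : cfc (fun x : ℝ => (c * x) ^ β) f = cfc (fun x : ℝ => c ^ β * x ^ β) f := by
    apply cfc_congr
    intro x hx
    have hx0 : 0 ≤ x := by
      rw [hf.1.spectrum_real_eq_range_eigenvalues] at hx
      obtain ⟨i, rfl⟩ := hx
      exact hf.posSemidef.eigenvalues_nonneg i
    exact Real.mul_rpow hc.le hx0
  rw [h4, cfc_const_mul _ _ _ (hcont _)]
  ext; simp

end Powers

section TraceForms

variable {ι : Type*} [Fintype ι]

/-- The real part of the trace. -/
noncomputable def reTr (A : Matrix ι ι ℂ) : ℝ := A.trace.re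

/-- The squared Frobenius norm. -/
noncomputable def frob (A : Matrix ι ι ℂ) : ℝ := reTr (Aᴴ * A)

theorem reTr_add (A B : Matrix ι ι ℂ) : reTr (A + B) = reTr A + reTr B := by
  simp [reTr, trace_add]

theorem reTr_sub (A B : Matrix ι ι ℂ) : reTr (A - B) = reTr A - reTr B := by
  simp [reTr, trace_sub]

theorem reTr_smul (c : ℝ) (A : Matrix ι ι ℂ) : reTr ((c : ℂ) • A) = c * reTr A := by
  simp [reTr, trace_smul]

theorem reTr_sum {κ : Type*} (s : Finset κ) (A : κ → Matrix ι ι ℂ) :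
    reTr (∑ k ∈ s, A k) = ∑ k ∈ s, reTr (A k) := by
  simp [reTr, trace_sum]

theorem reTr_mul_comm (A B : Matrix ι ι ℂ) : reTr (A * B) = reTr (B * A) := by
  rw [reTr, trace_mul_comm, reTr]

theorem reTr_conjTranspose (A : Matrix ι ι ℂ) : reTr Aᴴ = reTr A := by
  simp [reTr, trace_conjTranspose]

theorem reTr_nonneg {A : Matrix ι ι ℂ} (hA : A.PosSemidef) : 0 ≤ reTr A :=
  (Complex.le_def.1 hA.trace_nonneg).1

theorem reTr_mono {A B : Matrix ι ι ℂ} (h : (B - A).PosSemidef) : reTr A ≤ reTr B := by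
  have := reTr_nonneg h
  rw [reTr_sub] at this
  linarith

theorem trace_eq_reTr {A : Matrix ι ι ℂ} (hA : A.IsHermitian) : A.trace = (reTr A : ℂ) := by
  have h : (starRingEnd ℂ) A.trace = A.trace := by
    conv_rhs => rw [← hA.eq]
    rw [trace_conjTranspose]; rfl
  exact (Complex.conj_eq_iff_re.1 h).symm

theorem frob_eq_sum (A : Matrix ι ι ℂ) : frob A = ∑ i, ∑ j, ‖A i j‖ ^ 2 := by
  rw [frob, reTr, trace, Finset.sum_comm]
  simp only [diag_apply, mul_apply, conjTranspose_apply, Complex.re_sum]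
  refine Finset.sum_congr rfl fun i _ => Finset.sum_congr rfl fun j _ => ?_
  rw [Complex.star_def, ← Complex.normSq_eq_conj_mul_self, Complex.ofReal_re, Complex.normSq_eq_norm_sq]

theorem frob_nonneg (A : Matrix ι ι ℂ) : 0 ≤ frob A := by
  rw [frob_eq_sum]; positivity

theorem frob_conjTranspose (A : Matrix ι ι ℂ) : frob Aᴴ = frob A := by
  rw [frob, conjTranspose_conjTranspose, reTr_mul_comm, frob]

theorem frob_smul (c : ℂ) (A : Matrix ι ι ℂ) : frob (c • A) = ‖c‖ ^ 2 * frob A := by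
  simp only [frob_eq_sum, Finset.mul_sum, Matrix.smul_apply, smul_eq_mul, norm_mul, mul_pow]

theorem frob_add_le (A B : Matrix ι ι ℂ) : frob (A + B) ≤ 2 * (frob A + frob B) := by
  simp only [frob_eq_sum, ← Finset.sum_add_distrib, Finset.mul_sum]
  refine Finset.sum_le_sum fun i _ => Finset.sum_le_sum fun j _ => ?_
  have := norm_add_le (A i j) (B i j)
  have h0 := norm_nonneg (A i j + B i j)
  rw [Matrix.add_apply]
  nlinarith [sq_nonneg (‖A i j‖ - ‖B i j‖)]

theorem frob_le_frob {A B : Matrix ι ι ℂ} (h : ∀ i j, ‖A i j‖ ≤ ‖B i j‖) : frob A ≤ frob B := by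
  simp only [frob_eq_sum]
  gcongr
  exact h _ _

open scoped MatrixOrder Matrix.Norms.L2Operator in
theorem exists_eq_conjTranspose_mul_self {A : Matrix ι ι ℂ} (hA : A.PosSemidef) :
    ∃ C : Matrix ι ι ℂ, A = Cᴴ * C := by
  classical
  exact CStarAlgebra.nonneg_iff_eq_star_mul_self.1 (Matrix.nonneg_iff_posSemidef.2 hA)

theorem reTr_mul_nonneg {A B : Matrix ι ι ℂ} (hA : A.PosSemidef) (hB : B.PosSemidef) :
    0 ≤ reTr (A * B) := by
  classical
  obtain ⟨C, rfl⟩ := exists_eq_conjTranspose_mul_self hA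
  rw [reTr_mul_comm, ← Matrix.mul_assoc, reTr_mul_comm, ← Matrix.mul_assoc]
  exact reTr_nonneg (hB.mul_mul_conjTranspose_same C)

theorem reTr_mul_le_mul {A B C : Matrix ι ι ℂ} (hA : A.PosSemidef) (h : (C - B).PosSemidef) :
    reTr (A * B) ≤ reTr (A * C) := by
  have := reTr_mul_nonneg hA h
  rw [Matrix.mul_sub, reTr_sub] at this
  linarith

variable [DecidableEq ι]

theorem reTr_one : reTr (1 : Matrix ι ι ℂ) = Fintype.card ι := by
  simp [reTr]

theorem frob_unitary_mul {U : Matrix ι ι ℂ} (hU : Uᴴ * U = 1) (A : Matrix ι ι ℂ) :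
    frob (U * A) = frob A := by
  rw [frob, conjTranspose_mul, Matrix.mul_assoc, ← Matrix.mul_assoc Uᴴ, hU, Matrix.one_mul, frob]

theorem frob_mul_unitary {U : Matrix ι ι ℂ} (hU : U * Uᴴ = 1) (A : Matrix ι ι ℂ) :
    frob (A * U) = frob A := by
  rw [← frob_conjTranspose, conjTranspose_mul,
    frob_unitary_mul (by rw [conjTranspose_conjTranspose, hU]), frob_conjTranspose]

theorem reTr_diagonal_mul_mul (a b : ι → ℝ) (M : Matrix ι ι ℂ) :
    reTr (diagonal (fun i => (a i : ℂ)) * M * diagonal (fun i => (b i : ℂ)) * Mᴴ) =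
      ∑ i, ∑ j, a i * b j * ‖M i j‖ ^ 2 := by
  rw [reTr, trace, Complex.re_sum]
  refine Finset.sum_congr rfl fun i _ => ?_
  rw [diag_apply, mul_apply, Complex.re_sum]
  refine Finset.sum_congr rfl fun j _ => ?_
  rw [mul_diagonal, diagonal_mul, conjTranspose_apply, Complex.star_def]
  have : (a i : ℂ) * M i j * b j * (starRingEnd ℂ) (M i j) =
      ((a i * b j * ‖M i j‖ ^ 2 : ℝ) : ℂ) := by
    push_cast
    rw [← Complex.mul_conj']
    ring
  rw [this, Complex.ofReal_re]

/-- Schur complement duality. -/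
theorem posSemidef_inv_sub_of_posSemidef_sub {P H X : Matrix ι ι ℂ} (hP : P.PosDef)
    (hH : H.PosDef) (h : (H - X * P * Xᴴ).PosSemidef) : (P⁻¹ - Xᴴ * H⁻¹ * X).PosSemidef := by
  have := hP.inv.isUnit.invertible
  have := hH.isUnit.invertible
  rw [← PosDef.fromBlocks₁₁ (B := X) (D := P⁻¹) hH]
  rw [PosDef.fromBlocks₂₂ (A := H) (B := X) hP.inv]
  have := hP.isUnit.invertible
  rwa [Matrix.inv_inv_of_invertible]

theorem posSemidef_inv_sub_inv {A B : Matrix ι ι ℂ} (hA : A.PosDef) (hB : B.PosDef)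
    (h : (B - A).PosSemidef) : (A⁻¹ - B⁻¹).PosSemidef := by
  have := posSemidef_inv_sub_of_posSemidef_sub (X := 1) hA hB (by simpa using h)
  simpa using this

theorem reTr_posPow_mul_posPow {X D : Matrix ι ι ℂ} (hX : X.PosDef) (hD : D.PosDef) :
    ∃ M : Matrix ι ι ℂ, ∀ a b : ℝ, reTr (posPow X a * posPow D b) =
      ∑ i, ∑ j, hX.1.eigenvalues i ^ a * hD.1.eigenvalues j ^ b * ‖M i j‖ ^ 2 := by
  refine ⟨(hX.1.eigenvectorUnitary : Matrix ι ι ℂ)ᴴ * hD.1.eigenvectorUnitary, fun a b => ?_⟩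
  rw [← reTr_diagonal_mul_mul, posPow_eq_unitary hX.1, posPow_eq_unitary hD.1,
    Matrix.mul_assoc (_ * _), Matrix.mul_assoc (hX.1.eigenvectorUnitary : Matrix ι ι ℂ),
    reTr_mul_comm]
  simp only [conjTranspose_mul, conjTranspose_conjTranspose, Matrix.mul_assoc]

/-- A trace form of Klein's inequality for fractional powers. -/
theorem reTr_posPow_le {X D : Matrix ι ι ℂ} (hX : X.PosDef) (hD : D.PosDef) {r : ℝ}
    (hr0 : 0 < r) (hr1 : r < 1) :
    reTr (posPow X r) ≤ r * reTr (X * posPow D (r - 1)) + (1 - r) * reTr (posPow D r) := by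
  obtain ⟨M, hM⟩ := reTr_posPow_mul_posPow hX hD
  have h1 := hM r 0
  have h2 := hM 1 (r - 1)
  have h3 := hM 0 r
  rw [posPow_zero hD, Matrix.mul_one] at h1
  rw [posPow_one hX.posSemidef] at h2
  rw [posPow_zero hX, Matrix.one_mul] at h3
  rw [h1, h2, h3]
  simp only [Finset.mul_sum, ← Finset.sum_add_distrib]
  refine Finset.sum_le_sum fun i _ => Finset.sum_le_sum fun j _ => ?_
  have hx := hX.eigenvalues_pos i
  have hd := hD.eigenvalues_pos j
  set x := hX.1.eigenvalues i
  set d := hD.1.eigenvalues j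
  have key : x ^ r ≤ r * (x * d ^ (r - 1)) + (1 - r) * d ^ r := by
    have := Real.geom_mean_le_arith_mean2_weighted hr0.le (sub_nonneg.2 hr1.le)
      (p₁ := x * d ^ (r - 1)) (p₂ := d ^ r) (by positivity) (by positivity) (by ring)
    refine le_trans (le_of_eq ?_) this
    rw [Real.mul_rpow hx.le (by positivity), ← Real.rpow_mul hd.le, ← Real.rpow_mul hd.le,
      mul_assoc, ← Real.rpow_add hd]
    ring_nf
    simp
  simp only [Real.rpow_zero, Real.rpow_one, mul_one, one_mul]
  calc x ^ r * ‖M i j‖ ^ 2 ≤ (r * (x * d ^ (r - 1)) + (1 - r) * d ^ r) * ‖M i j‖ ^ 2 := by gcongr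
    _ = _ := by ring

theorem posPow_neg_antitone {A B : Matrix ι ι ℂ} (hA : A.PosDef) (hB : B.PosDef)
    (h : (B - A).PosSemidef) {s : ℝ} (hs0 : 0 ≤ s) (hs1 : s ≤ 1) :
    (posPow A (-s) - posPow B (-s)).PosSemidef := by
  rw [posPow_neg_eq_inv hA, posPow_neg_eq_inv hB]
  exact posSemidef_inv_sub_inv (posPow_posDef hA s) (posPow_posDef hB s)
    (posPow_le_posPow hA hB h hs0 hs1)

/-- Subadditivity of the trace of a fractional power. -/
theorem reTr_posPow_add_le {A B : Matrix ι ι ℂ} (hA : A.PosDef) (hB : B.PosDef) {r : ℝ}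
    (hr0 : 0 < r) (hr1 : r < 1) :
    reTr (posPow (A + B) r) ≤ reTr (posPow A r) + reTr (posPow B r) := by
  have hAB := hA.add hB
  have e : ∀ {C : Matrix ι ι ℂ}, C.PosDef → posPow C r = C * posPow C (-(1 - r)) := by
    intro C hC
    conv_rhs => enter [1]; rw [← posPow_one hC.posSemidef]
    rw [posPow_mul_posPow hC]
    congr 1; ring
  rw [e hA, e hB, e hAB, Matrix.add_mul, reTr_add]
  refine add_le_add (reTr_mul_le_mul hA.posSemidef ?_) (reTr_mul_le_mul hB.posSemidef ?_)
  · exact posPow_neg_antitone hA hAB (by simpa using hB.posSemidef) (by linarith) (by linarith)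
  · exact posPow_neg_antitone hB hAB (by simpa using hA.posSemidef) (by linarith) (by linarith)

theorem reTr_posPow_conj_le_one {f G : Matrix ι ι ℂ} (hf : f.PosDef) (hG : G.PosDef)
    (hf1 : reTr f = 1) (hG1 : reTr G = 1) {β : ℝ} (hβ : 0 < β) :
    reTr (posPow (posPow f β * G * posPow f β) (1 / (2 * β + 1))) ≤ 1 := by
  have h1 : 0 < 2 * β + 1 := by linarith
  set r := 1 / (2 * β + 1) with hr
  have hr0 : 0 < r := by positivity
  have hr1 : r < 1 := by rw [hr, div_lt_one h1]; linarith
  have hX : (posPow f β * G * posPow f β).PosDef := by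
    have hb := posPow_posDef hf β
    have := hb.isUnit
    conv => enter [1, 2]; rw [← hb.1.eq]
    exact (Matrix.IsUnit.posDef_star_right_conjugate_iff this).2 hG
  have h := reTr_posPow_le hX (posPow_posDef hf (2 * β + 1)) hr0 hr1
  rw [posPow_posPow hf _ _ h1.ne', posPow_posPow hf _ _ h1.ne'] at h
  have e1 : (2 * β + 1) * (r - 1) = -β + -β := by rw [hr]; field_simp; ring
  have e2 : (2 * β + 1) * r = 1 := by rw [hr]; field_simp
  rw [e1, e2, posPow_one hf.posSemidef, hf1, ← posPow_mul_posPow hf, reTr_mul_comm] at h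
  have e3 : posPow f (-β) * posPow f (-β) * (posPow f β * G * posPow f β) =
      posPow f (-β) * (posPow f (-β) * posPow f β) * (G * posPow f β) := by
    simp only [Matrix.mul_assoc]
  rw [e3, posPow_neg_mul_self hf, Matrix.mul_one, reTr_mul_comm, Matrix.mul_assoc G,
    posPow_mul_neg_self hf, Matrix.mul_one, hG1] at h
  linarith

end TraceForms

section Duality

variable {ι κ : Type*} [Fintype ι] [Fintype κ]

theorem frob_mul_le (A B : Matrix ι ι ℂ) : frob (A * B) ≤ frob A * frob B := by
  simp only [frob_eq_sum]
  rw [Finset.sum_comm (f := fun i j => ‖B i j‖ ^ 2), Finset.sum_mul_sum]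
  refine Finset.sum_le_sum fun i _ => Finset.sum_le_sum fun j _ => ?_
  have h : ‖(A * B) i j‖ ≤ ∑ k, ‖A i k‖ * ‖B k j‖ := by
    rw [mul_apply]
    exact (norm_sum_le _ _).trans (by simp)
  exact (pow_le_pow_left₀ (norm_nonneg _) h 2).trans (Finset.sum_mul_sq_le_sq_mul_sq _ _ _)

theorem frob_le_sq_reTr {S : Matrix ι ι ℂ} (hS : S.PosSemidef) : frob S ≤ reTr S ^ 2 := by
  obtain ⟨C, rfl⟩ := exists_eq_conjTranspose_mul_self hS
  have := frob_mul_le Cᴴ C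
  rw [frob_conjTranspose] at this
  rw [sq]
  exact this

theorem norm_apply_le_sqrt_frob (A : Matrix ι ι ℂ) (i j : ι) : ‖A i j‖ ≤ √(frob A) := by
  refine Real.le_sqrt_of_sq_le ?_
  rw [frob_eq_sum]
  calc ‖A i j‖ ^ 2 ≤ ∑ j, ‖A i j‖ ^ 2 :=
        Finset.single_le_sum (f := fun j => ‖A i j‖ ^ 2) (fun _ _ => by positivity)
          (Finset.mem_univ j)
    _ ≤ _ := Finset.single_le_sum (f := fun i => ∑ j, ‖A i j‖ ^ 2)
          (fun _ _ => by positivity) (Finset.mem_univ i)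

theorem eq_zero_of_frob_eq_zero {A : Matrix ι ι ℂ} (h : frob A = 0) : A = 0 := by
  ext i j
  have := norm_apply_le_sqrt_frob A i j
  rw [h, Real.sqrt_zero] at this
  simpa using this

theorem isClosed_setOf_posSemidef : IsClosed {A : Matrix ι ι ℂ | A.PosSemidef} := by
  simp only [posSemidef_iff_dotProduct_mulVec, Set.ofPred_and, Set.ofPred_forall]
  refine IsClosed.inter ?_ (isClosed_iInter fun x => ?_)
  · exact isClosed_eq (by fun_prop) continuous_id
  · refine isClosed_le continuous_const ?_
    exact continuous_const.dotProduct (continuous_id.matrix_mulVec continuous_const)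

variable [DecidableEq ι]

omit [Fintype ι] in
theorem posDef_smul_one_add {A : Matrix ι ι ℂ} (hA : A.PosSemidef) {δ : ℝ} (hδ : 0 < δ) :
    (((δ ^ 2 : ℝ) : ℂ) • (1 : Matrix ι ι ℂ) + A).PosDef :=
  (PosDef.one.smul (by exact_mod_cast pow_pos hδ 2)).add_posSemidef hA

theorem exists_posDef_mul_self_eq {A : Matrix ι ι ℂ} (hA : A.PosDef) :
    ∃ S : Matrix ι ι ℂ, S.PosDef ∧ S * S = A :=
  ⟨posPow A (1 / 2), posPow_posDef hA _, by
    rw [posPow_mul_posPow hA, add_halves, posPow_one hA.posSemidef]⟩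

theorem posDef_of_mul_self {S A : Matrix ι ι ℂ} (hS : S.PosSemidef) (hA : A.PosDef)
    (h : S * S = A) : S.PosDef := by
  rw [hS.posDef_iff_isUnit]
  have := hA.isUnit
  rw [← h] at this
  exact isUnit_of_mul_isUnit_left this

theorem two_mul_reTr_le {S S' : Matrix ι ι ℂ} (hS : S.PosDef) (hS' : S'.IsHermitian) :
    2 * reTr S' ≤ reTr (S' * S' * S⁻¹) + reTr S := by
  have h := reTr_nonneg (hS.inv.posSemidef.mul_mul_conjTranspose_same (S' - S))
  have hu : IsUnit S.det := (Matrix.isUnit_iff_isUnit_det S).1 hS.isUnit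
  have e : (S' - S) * S⁻¹ * (S' - S)ᴴ = S' * S⁻¹ * S' - S' - S' + S := by
    rw [conjTranspose_sub, hS'.eq, hS.1.eq]
    simp only [Matrix.sub_mul, Matrix.mul_sub, Matrix.mul_nonsing_inv _ hu, Matrix.one_mul,
      Matrix.mul_assoc, Matrix.nonsing_inv_mul _ hu, Matrix.mul_one]
    abel
  rw [e, reTr_add, reTr_sub, reTr_sub, reTr_mul_comm, ← Matrix.mul_assoc] at h
  linarith

theorem eq_zero_of_forall_quadratic_nonneg {a b : ℝ} (h : ∀ t : ℝ, 0 ≤ t * a + t ^ 2 * b) :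
    a = 0 := by
  by_contra ha
  have h1 := h (-a / (2 * (|b| + 1)))
  have h2 : 0 < 2 * (|b| + 1) := by positivity
  have h3 : -a / (2 * (|b| + 1)) * a + (-a / (2 * (|b| + 1))) ^ 2 * b =
      a ^ 2 / (2 * (|b| + 1)) ^ 2 * (b - 2 * (|b| + 1)) := by
    field_simp
    ring
  rw [h3] at h1
  have h4 : 0 < a ^ 2 / (2 * (|b| + 1)) ^ 2 := by positivity
  have h5 : b - 2 * (|b| + 1) < 0 := by have := le_abs_self b; have := abs_nonneg b; linarith
  exact absurd h1 (not_le.2 (mul_neg_of_pos_of_neg h4 h5))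

section Minimizer

attribute [local instance] Matrix.normedAddCommGroup

theorem exists_minimal_decomposition (z : κ → Matrix ι ι ℂ) {δ : ℝ} (hδ : 0 < δ) :
    ∃ (a : κ → Matrix ι ι ℂ) (S T : Matrix ι ι ℂ), S.PosDef ∧ T.PosDef ∧
      S * S = ((δ ^ 2 : ℝ) : ℂ) • (1 : Matrix ι ι ℂ) + ∑ k, (a k)ᴴ * a k ∧
      T * T = ((δ ^ 2 : ℝ) : ℂ) • (1 : Matrix ι ι ℂ) + ∑ k, (z k - a k) * (z k - a k)ᴴ ∧
      ∀ (a' : κ → Matrix ι ι ℂ) (S' T' : Matrix ι ι ℂ), S'.PosDef → T'.PosDef →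
        S' * S' = ((δ ^ 2 : ℝ) : ℂ) • (1 : Matrix ι ι ℂ) + ∑ k, (a' k)ᴴ * a' k →
        T' * T' = ((δ ^ 2 : ℝ) : ℂ) • (1 : Matrix ι ι ℂ) + ∑ k, (z k - a' k) * (z k - a' k)ᴴ →
        reTr S + reTr T ≤ reTr S' + reTr T' := by
  let Φ : (κ → Matrix ι ι ℂ) × Matrix ι ι ℂ × Matrix ι ι ℂ → ℝ := fun w => reTr w.2.1 + reTr w.2.2
  let K : Set ((κ → Matrix ι ι ℂ) × Matrix ι ι ℂ × Matrix ι ι ℂ) :=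
    {w | w.2.1.PosSemidef ∧ w.2.2.PosSemidef ∧
      w.2.1 * w.2.1 = ((δ ^ 2 : ℝ) : ℂ) • (1 : Matrix ι ι ℂ) + ∑ k, (w.1 k)ᴴ * w.1 k ∧
      w.2.2 * w.2.2 =
        ((δ ^ 2 : ℝ) : ℂ) • (1 : Matrix ι ι ℂ) + ∑ k, (z k - w.1 k) * (z k - w.1 k)ᴴ}
  have hpsd1 : ∀ a : κ → Matrix ι ι ℂ, (∑ k, (a k)ᴴ * a k).PosSemidef :=
    fun a => posSemidef_sum _ fun k _ => posSemidef_conjTranspose_mul_self _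
  have hpsd2 : ∀ a : κ → Matrix ι ι ℂ, (∑ k, a k * (a k)ᴴ).PosSemidef :=
    fun a => posSemidef_sum _ fun k _ => posSemidef_self_mul_conjTranspose _
  have hΦ : Continuous Φ := by
    have h1 : Continuous fun A : Matrix ι ι ℂ => reTr A :=
      Complex.continuous_re.comp (Continuous.matrix_trace continuous_id)
    exact (h1.comp (by fun_prop)).add (h1.comp (by fun_prop))
  have hK : IsClosed K := by
    refine IsClosed.inter (isClosed_setOf_posSemidef.preimage (by fun_prop))
      (IsClosed.inter (isClosed_setOf_posSemidef.preimage (by fun_prop))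
      (IsClosed.inter (isClosed_eq ?_ ?_) (isClosed_eq ?_ ?_))) <;> fun_prop
  obtain ⟨S0, hS0, hS0'⟩ := exists_posDef_mul_self_eq (posDef_smul_one_add (hpsd1 0) hδ)
  obtain ⟨T0, hT0, hT0'⟩ := exists_posDef_mul_self_eq (posDef_smul_one_add (hpsd2 (z - 0)) hδ)
  have hw0 : (0, S0, T0) ∈ K := ⟨hS0.posSemidef, hT0.posSemidef, hS0', hT0'⟩
  set v := Φ (0, S0, T0) with hv
  have hv0 : 0 ≤ v := add_nonneg (reTr_nonneg hS0.posSemidef) (reTr_nonneg hT0.posSemidef)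
  have hcomp : IsCompact (K ∩ {w | Φ w ≤ v}) := by
    have : ProperSpace (Matrix ι ι ℂ) := inferInstanceAs (ProperSpace (ι → ι → ℂ))
    refine Metric.isCompact_of_isClosed_isBounded
      (hK.inter (isClosed_le hΦ continuous_const)) ?_
    refine (Metric.isBounded_closedBall (x := 0) (r := v)).subset ?_
    rintro ⟨a, S, T⟩ ⟨⟨hS, hT, hSS, hTT⟩, hle⟩
    simp only [Φ, Set.mem_ofPred_eq] at hS hT hSS hTT hle
    have hS0 := reTr_nonneg hS
    have hT0 := reTr_nonneg hT
    have bound : ∀ A : Matrix ι ι ℂ, frob A ≤ v ^ 2 → ‖A‖ ≤ v := by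
      intro A hA
      rw [Matrix.norm_le_iff hv0]
      intro i j
      refine (norm_apply_le_sqrt_frob A i j).trans ?_
      rw [← Real.sqrt_sq hv0]
      exact Real.sqrt_le_sqrt hA
    have hSv : frob S ≤ v ^ 2 :=
      (frob_le_sq_reTr hS).trans (pow_le_pow_left₀ hS0 (by linarith) 2)
    have hTv : frob T ≤ v ^ 2 :=
      (frob_le_sq_reTr hT).trans (pow_le_pow_left₀ hT0 (by linarith) 2)
    rw [mem_closedBall_zero_iff, Prod.norm_def, Prod.norm_def]
    refine max_le ?_ (max_le (bound S hSv) (bound T hTv))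
    refine (pi_norm_le_iff_of_nonneg hv0).2 fun k => bound _ (le_trans ?_ hSv)
    have h1 : frob S = δ ^ 2 * Fintype.card ι + ∑ k, frob (a k) := by
      rw [frob, hS.1.eq, hSS, reTr_add, reTr_smul, reTr_one, reTr_sum]
      rfl
    rw [h1]
    have h2 : frob (a k) ≤ ∑ k, frob (a k) :=
      Finset.single_le_sum (f := fun k => frob (a k)) (fun _ _ => frob_nonneg _)
        (Finset.mem_univ k)
    have : 0 ≤ δ ^ 2 * (Fintype.card ι : ℝ) := by positivity
    linarith
  obtain ⟨⟨a, S, T⟩, ⟨⟨hS, hT, hSS, hTT⟩, hle⟩, hmin⟩ :=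
    hcomp.exists_isMinOn ⟨(0, S0, T0), hw0, show Φ (0, S0, T0) ≤ v from le_rfl⟩ hΦ.continuousOn
  refine ⟨a, S, T, posDef_of_mul_self hS (posDef_smul_one_add (hpsd1 a) hδ) hSS,
    posDef_of_mul_self hT (posDef_smul_one_add (hpsd2 (z - a)) hδ) hTT, hSS, hTT, ?_⟩
  intro a' S' T' hS' hT' hSS' hTT'
  by_cases hc : reTr S' + reTr T' ≤ v
  · exact hmin (a := (a', S', T')) ⟨⟨hS'.posSemidef, hT'.posSemidef, hSS', hTT'⟩, hc⟩
  · exact hle.trans (not_le.1 hc).le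

end Minimizer

theorem reTr_inv_le {S A : Matrix ι ι ℂ} (hS : S.PosDef) (hA : A.PosSemidef) {δ : ℝ}
    (h : S * S = ((δ ^ 2 : ℝ) : ℂ) • (1 : Matrix ι ι ℂ) + A) :
    S⁻¹ * A * S⁻¹ = 1 - ((δ ^ 2 : ℝ) : ℂ) • (S⁻¹ * S⁻¹) ∧
      δ * reTr S⁻¹ ≤ Fintype.card ι := by
  have hu : IsUnit S.det := (Matrix.isUnit_iff_isUnit_det S).1 hS.isUnit
  have e : S⁻¹ * A * S⁻¹ = 1 - ((δ ^ 2 : ℝ) : ℂ) • (S⁻¹ * S⁻¹) := by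
    have hA' : A = S * S - ((δ ^ 2 : ℝ) : ℂ) • (1 : Matrix ι ι ℂ) := by rw [h]; abel
    rw [hA', Matrix.mul_sub, Matrix.sub_mul, Matrix.mul_smul, Matrix.mul_one, Matrix.smul_mul,
      ← Matrix.mul_assoc, Matrix.nonsing_inv_mul _ hu, Matrix.one_mul, Matrix.mul_nonsing_inv _ hu]
  refine ⟨e, ?_⟩
  have hR := hS.inv
  set R := S⁻¹
  have h1 : 0 ≤ reTr (R * A * R) := by
    have := reTr_nonneg (hA.mul_mul_conjTranspose_same R)
    rwa [hR.1.eq] at this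
  rw [e, reTr_sub, reTr_one, reTr_smul] at h1
  have h2 := reTr_nonneg (posSemidef_conjTranspose_mul_self (1 - (δ : ℂ) • R))
  have e2 : (1 - (δ : ℂ) • R)ᴴ * (1 - (δ : ℂ) • R) =
      1 - (δ : ℂ) • R - (δ : ℂ) • R + ((δ ^ 2 : ℝ) : ℂ) • (R * R) := by
    rw [conjTranspose_sub, conjTranspose_smul, hR.1.eq, conjTranspose_one]
    simp only [Complex.star_def, Complex.conj_ofReal, Matrix.sub_mul, Matrix.mul_sub,
      Matrix.one_mul, Matrix.mul_one, Matrix.smul_mul, Matrix.mul_smul]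
    push_cast
    module
  rw [e2, reTr_add, reTr_sub, reTr_sub, reTr_one, reTr_smul, reTr_smul] at h2
  linarith

theorem stationary_of_minimal {z a : κ → Matrix ι ι ℂ} {S T : Matrix ι ι ℂ} {δ : ℝ} (hδ : 0 < δ)
    (hS : S.PosDef) (hT : T.PosDef)
    (hSS : S * S = ((δ ^ 2 : ℝ) : ℂ) • (1 : Matrix ι ι ℂ) + ∑ k, (a k)ᴴ * a k)
    (hTT : T * T = ((δ ^ 2 : ℝ) : ℂ) • (1 : Matrix ι ι ℂ) + ∑ k, (z k - a k) * (z k - a k)ᴴ)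
    (hmin : ∀ (a' : κ → Matrix ι ι ℂ) (S' T' : Matrix ι ι ℂ), S'.PosDef → T'.PosDef →
        S' * S' = ((δ ^ 2 : ℝ) : ℂ) • (1 : Matrix ι ι ℂ) + ∑ k, (a' k)ᴴ * a' k →
        T' * T' = ((δ ^ 2 : ℝ) : ℂ) • (1 : Matrix ι ι ℂ) + ∑ k, (z k - a' k) * (z k - a' k)ᴴ →
        reTr S + reTr T ≤ reTr S' + reTr T') (k : κ) :
    a k * S⁻¹ = T⁻¹ * (z k - a k) := by
  have hSu : IsUnit S.det := (Matrix.isUnit_iff_isUnit_det S).1 hS.isUnit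
  have hTu : IsUnit T.det := (Matrix.isUnit_iff_isUnit_det T).1 hT.isUnit
  set h : κ → Matrix ι ι ℂ := fun k => a k * S⁻¹ - T⁻¹ * (z k - a k) with hh
  have key : ∀ t : ℝ, 0 ≤ t * (2 * ∑ k, frob (h k)) +
      t ^ 2 * (∑ k, reTr ((h k)ᴴ * h k * S⁻¹) + ∑ k, reTr (h k * (h k)ᴴ * T⁻¹)) := by
    intro t
    set a' : κ → Matrix ι ι ℂ := fun k => a k + (t : ℂ) • h k with ha'
    obtain ⟨S', hS', hS''⟩ := exists_posDef_mul_self_eq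
      (posDef_smul_one_add (posSemidef_sum Finset.univ fun k _ =>
        posSemidef_conjTranspose_mul_self (a' k)) hδ)
    obtain ⟨T', hT', hT''⟩ := exists_posDef_mul_self_eq
      (posDef_smul_one_add (posSemidef_sum Finset.univ fun k _ =>
        posSemidef_self_mul_conjTranspose (z k - a' k)) hδ)
    have h1 := hmin a' S' T' hS' hT' hS'' hT''
    have h2 := two_mul_reTr_le hS hS'.1
    have h3 := two_mul_reTr_le hT hT'.1
    have e1 : S' * S' = S * S + ∑ k, ((t : ℂ) • ((a k)ᴴ * h k + (h k)ᴴ * a k) +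
        ((t ^ 2 : ℝ) : ℂ) • ((h k)ᴴ * h k)) := by
      rw [hS'', hSS, add_assoc, ← Finset.sum_add_distrib]
      congr 1
      refine Finset.sum_congr rfl fun k _ => ?_
      simp only [ha', conjTranspose_add, conjTranspose_smul, Complex.star_def, Complex.conj_ofReal,
        Matrix.add_mul, Matrix.mul_add, Matrix.smul_mul, Matrix.mul_smul]
      push_cast
      module
    have e2 : T' * T' = T * T + ∑ k, (-(t : ℂ) • ((z k - a k) * (h k)ᴴ + h k * (z k - a k)ᴴ) +
        ((t ^ 2 : ℝ) : ℂ) • (h k * (h k)ᴴ)) := by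
      rw [hT'', hTT, add_assoc, ← Finset.sum_add_distrib]
      congr 1
      refine Finset.sum_congr rfl fun k _ => ?_
      have : z k - a' k = (z k - a k) - (t : ℂ) • h k := by simp only [ha']; abel
      rw [this]
      generalize z k - a k = b
      simp only [conjTranspose_sub, conjTranspose_smul, Complex.star_def, Complex.conj_ofReal,
        Matrix.sub_mul, Matrix.mul_sub, Matrix.smul_mul, Matrix.mul_smul]
      push_cast
      module
    have f1 : reTr (S' * S' * S⁻¹) = reTr S + ∑ k, (2 * t * reTr ((h k)ᴴ * (a k * S⁻¹)) +
        t ^ 2 * reTr ((h k)ᴴ * h k * S⁻¹)) := by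
      rw [e1, Matrix.add_mul, Matrix.mul_assoc, Matrix.mul_nonsing_inv _ hSu, Matrix.mul_one,
        reTr_add, Finset.sum_mul, reTr_sum]
      congr 1
      refine Finset.sum_congr rfl fun k _ => ?_
      rw [Matrix.add_mul, Matrix.smul_mul, Matrix.smul_mul, reTr_add, reTr_smul, reTr_smul,
        Matrix.add_mul, reTr_add]
      have : reTr ((a k)ᴴ * h k * S⁻¹) = reTr ((h k)ᴴ * (a k * S⁻¹)) := by
        rw [← reTr_conjTranspose]
        simp only [conjTranspose_mul, conjTranspose_conjTranspose]
        rw [hS.inv.1.eq, reTr_mul_comm, Matrix.mul_assoc]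
      rw [this, Matrix.mul_assoc]
      ring
    have f2 : reTr (T' * T' * T⁻¹) = reTr T + ∑ k, (-2 * t * reTr ((h k)ᴴ * (T⁻¹ * (z k - a k))) +
        t ^ 2 * reTr (h k * (h k)ᴴ * T⁻¹)) := by
      rw [e2, Matrix.add_mul, Matrix.mul_assoc, Matrix.mul_nonsing_inv _ hTu, Matrix.mul_one,
        reTr_add, Finset.sum_mul, reTr_sum]
      congr 1
      refine Finset.sum_congr rfl fun k _ => ?_
      rw [Matrix.add_mul, Matrix.smul_mul, Matrix.smul_mul, reTr_add, ← Complex.ofReal_neg,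
        reTr_smul, reTr_smul, Matrix.add_mul, reTr_add]
      generalize z k - a k = b
      have h1 : reTr (h k * bᴴ * T⁻¹) = reTr ((h k)ᴴ * (T⁻¹ * b)) := by
        rw [← reTr_conjTranspose]
        simp only [conjTranspose_mul, conjTranspose_conjTranspose]
        rw [hT.inv.1.eq, ← Matrix.mul_assoc, reTr_mul_comm]
      have h2 : reTr (b * (h k)ᴴ * T⁻¹) = reTr ((h k)ᴴ * (T⁻¹ * b)) := by
        rw [Matrix.mul_assoc, reTr_mul_comm, Matrix.mul_assoc]
      rw [h1, h2]
      ring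
    have f3 : ∀ k, frob (h k) = reTr ((h k)ᴴ * (a k * S⁻¹)) -
        reTr ((h k)ᴴ * (T⁻¹ * (z k - a k))) := by
      intro k
      rw [← reTr_sub, ← Matrix.mul_sub]
      rfl
    rw [Finset.sum_congr rfl fun k _ => f3 k]
    rw [Finset.sum_add_distrib, ← Finset.mul_sum, ← Finset.mul_sum] at f1 f2
    rw [Finset.sum_sub_distrib]
    linarith
  have h0 := eq_zero_of_forall_quadratic_nonneg key
  have h1 : ∑ k, frob (h k) = 0 := by linarith
  have h2 := (Finset.sum_eq_zero_iff_of_nonneg fun k _ => frob_nonneg (h k)).1 h1 k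
    (Finset.mem_univ k)
  exact sub_eq_zero.1 (eq_zero_of_frob_eq_zero h2)

/-- Dual form of the decomposition of a finite sequence into a row part and a column part. -/
theorem exists_dual_decomposition (z : κ → Matrix ι ι ℂ) {δ : ℝ} (hδ : 0 < δ) :
    ∃ (c : κ → Matrix ι ι ℂ) (S T : Matrix ι ι ℂ), S.PosDef ∧ T.PosDef ∧
      (∀ k, z k = c k * S + T * c k) ∧
      (1 - ∑ k, (c k)ᴴ * c k).PosSemidef ∧ (1 - ∑ k, c k * (c k)ᴴ).PosSemidef ∧
      reTr S + reTr T - 2 * Fintype.card ι * δ ≤ ∑ k, reTr ((c k)ᴴ * z k) := by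
  obtain ⟨a, S, T, hS, hT, hSS, hTT, hmin⟩ := exists_minimal_decomposition z hδ
  have hst := stationary_of_minimal hδ hS hT hSS hTT hmin
  have hSu : IsUnit S.det := (Matrix.isUnit_iff_isUnit_det S).1 hS.isUnit
  have hTu : IsUnit T.det := (Matrix.isUnit_iff_isUnit_det T).1 hT.isUnit
  obtain ⟨eS, hS1⟩ := reTr_inv_le hS (posSemidef_sum Finset.univ fun k _ =>
        posSemidef_conjTranspose_mul_self (a k)) hSS
  obtain ⟨eT, hT1⟩ := reTr_inv_le hT (posSemidef_sum Finset.univ fun k _ =>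
        posSemidef_self_mul_conjTranspose (z k - a k)) hTT
  have eC : ∑ k, (a k * S⁻¹)ᴴ * (a k * S⁻¹) = 1 - ((δ ^ 2 : ℝ) : ℂ) • (S⁻¹ * S⁻¹) := by
    rw [← eS, Finset.mul_sum, Finset.sum_mul]
    refine Finset.sum_congr rfl fun k _ => ?_
    rw [conjTranspose_mul, hS.inv.1.eq]
    simp only [Matrix.mul_assoc]
  have eD : ∑ k, (a k * S⁻¹) * (a k * S⁻¹)ᴴ = 1 - ((δ ^ 2 : ℝ) : ℂ) • (T⁻¹ * T⁻¹) := by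
    rw [← eT, Finset.mul_sum, Finset.sum_mul]
    refine Finset.sum_congr rfl fun k _ => ?_
    rw [hst, conjTranspose_mul, hT.inv.1.eq]
    simp only [Matrix.mul_assoc]
  have hpos : ∀ {R : Matrix ι ι ℂ}, R.PosDef → (((δ ^ 2 : ℝ) : ℂ) • (R⁻¹ * R⁻¹)).PosSemidef := by
    intro R hR
    have := posSemidef_conjTranspose_mul_self R⁻¹
    rw [hR.inv.1.eq] at this
    exact this.smul (by exact_mod_cast sq_nonneg δ)
  have hz : ∀ k, z k = (a k * S⁻¹) * S + T * (a k * S⁻¹) := by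
    intro k
    conv_rhs => enter [2]; rw [hst]
    rw [Matrix.mul_assoc, Matrix.nonsing_inv_mul _ hSu, Matrix.mul_one, ← Matrix.mul_assoc,
      Matrix.mul_nonsing_inv _ hTu, Matrix.one_mul]
    abel
  refine ⟨fun k => a k * S⁻¹, S, T, hS, hT, hz, ?_, ?_, ?_⟩
  · rw [eC, sub_sub_cancel]; exact hpos hS
  · rw [eD, sub_sub_cancel]; exact hpos hT
  · have e : ∀ k, reTr ((a k * S⁻¹)ᴴ * z k) = reTr ((a k * S⁻¹)ᴴ * (a k * S⁻¹) * S) +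
        reTr (T * ((a k * S⁻¹) * (a k * S⁻¹)ᴴ)) := by
      intro k
      conv_lhs => rw [hz k]
      generalize a k * S⁻¹ = c
      rw [Matrix.mul_add, reTr_add, ← Matrix.mul_assoc, ← Matrix.mul_assoc, reTr_mul_comm (cᴴ * T),
        ← Matrix.mul_assoc, reTr_mul_comm (c * cᴴ)]
    rw [Finset.sum_congr rfl fun k _ => e k, Finset.sum_add_distrib, ← reTr_sum, ← reTr_sum,
      ← Finset.sum_mul, ← Finset.mul_sum, eC, eD, Matrix.sub_mul, Matrix.mul_sub, Matrix.one_mul,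
      Matrix.mul_one, Matrix.smul_mul, Matrix.mul_smul, reTr_sub, reTr_sub, reTr_smul, reTr_smul,
      Matrix.mul_assoc, Matrix.nonsing_inv_mul _ hSu, Matrix.mul_one, ← Matrix.mul_assoc,
      Matrix.mul_nonsing_inv _ hTu, Matrix.one_mul]
    nlinarith

end Duality

section Signs

/-- The average over all choices of signs. -/
noncomputable def signAvg {N : ℕ} (F : (Fin N → Bool) → ℝ) : ℝ := (1 / 2 ^ N) * ∑ ε, F ε

/-- The sum of a finite sequence with prescribed signs. -/
def signSum {N : ℕ} {V : Type*} [AddCommGroup V] (ε : Fin N → Bool) (x : Fin N → V) : V :=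
  ∑ k, if ε k then x k else -x k

theorem signAvg_succ {N : ℕ} (F : (Fin (N + 1) → Bool) → ℝ) :
    signAvg F = (signAvg (fun ε => F (Fin.cons true ε)) +
      signAvg (fun ε => F (Fin.cons false ε))) / 2 := by
  have h : ∑ ε, F ε = ∑ b : Bool, ∑ ε : Fin N → Bool, F (Fin.cons b ε) := by
    rw [← Fintype.sum_prod_type']
    exact (Fintype.sum_equiv (Fin.consEquiv fun _ => Bool) _ _ fun _ => rfl).symm
  simp only [signAvg]
  rw [h, Fintype.sum_bool, pow_succ]
  field_simp

theorem signAvg_add {N : ℕ} (F G : (Fin N → Bool) → ℝ) :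
    signAvg (fun ε => F ε + G ε) = signAvg F + signAvg G := by
  simp only [signAvg, Finset.sum_add_distrib, mul_add]

theorem signAvg_const_mul {N : ℕ} (c : ℝ) (F : (Fin N → Bool) → ℝ) :
    signAvg (fun ε => c * F ε) = c * signAvg F := by
  simp only [signAvg, ← Finset.mul_sum]
  ring

theorem signAvg_const {N : ℕ} (c : ℝ) : signAvg (fun _ : Fin N → Bool => c) = c := by
  simp [signAvg]

theorem signAvg_mono {N : ℕ} {F G : (Fin N → Bool) → ℝ} (h : ∀ ε, F ε ≤ G ε) :
    signAvg F ≤ signAvg G := by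
  unfold signAvg
  gcongr
  exact h _

variable {V : Type*} [AddCommGroup V]

theorem signSum_cons_true {N : ℕ} (ε : Fin N → Bool) (x : Fin (N + 1) → V) :
    signSum (Fin.cons true ε) x = signSum ε (fun k => x k.succ) + x 0 := by
  simp [signSum, Fin.sum_univ_succ, add_comm]

theorem signSum_cons_false {N : ℕ} (ε : Fin N → Bool) (x : Fin (N + 1) → V) :
    signSum (Fin.cons false ε) x = signSum ε (fun k => x k.succ) - x 0 := by
  simp [signSum, Fin.sum_univ_succ, sub_eq_add_neg, add_comm]

theorem map_signSum {W F : Type*} [AddCommGroup W] [FunLike F V W] [AddMonoidHomClass F V W]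
    (f : F) {N : ℕ} (ε : Fin N → Bool) (x : Fin N → V) :
    f (signSum ε x) = signSum ε (fun k => f (x k)) := by
  simp only [signSum, map_sum]
  refine Finset.sum_congr rfl fun k _ => ?_
  split_ifs <;> simp

theorem signAvg_bilinear {W : Type*} [AddCommGroup W] (B : V → W → ℝ)
    (hl : ∀ x y z, B (x + y) z = B x z + B y z) (hr : ∀ x y z, B x (y + z) = B x y + B x z)
    {N : ℕ} (x : Fin N → V) (z : Fin N → W) :
    signAvg (fun ε => B (signSum ε x) (signSum ε z)) = ∑ k, B (x k) (z k) := by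
  have hl' : ∀ x y z, B (x - y) z = B x z - B y z := by
    intro x y z
    have := hl (x - y) y z
    rw [sub_add_cancel] at this
    linarith
  have hr' : ∀ x y z, B x (y - z) = B x y - B x z := by
    intro x y z
    have := hr x (y - z) z
    rw [sub_add_cancel] at this
    linarith
  induction N with
  | zero =>
    have h0 : B 0 0 = 0 := by simpa using hl 0 0 0
    simp [signAvg, signSum, h0]
  | succ N ih =>
    rw [signAvg_succ, ← signAvg_add]
    simp only [signSum_cons_true, signSum_cons_false, hl, hr, hl', hr']
    have e : ∀ p q r s : ℝ, p + r + (q + s) + (p - r - (q - s)) = 2 * (p + s) := by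
      intros; ring
    simp only [e]
    rw [signAvg_const_mul, signAvg_add, signAvg_const, ih, Fin.sum_univ_succ]
    ring

end Signs

section Khintchine

variable {ι : Type*} [Fintype ι]

theorem signAvg_frob {N : ℕ} (y : Fin N → Matrix ι ι ℂ) :
    signAvg (fun ε => frob (signSum ε y)) = ∑ k, frob (y k) := by
  refine signAvg_bilinear (fun a b => reTr (aᴴ * b)) ?_ ?_ y y
  · intro x y z; rw [conjTranspose_add, Matrix.add_mul, reTr_add]
  · intro x y z; rw [Matrix.mul_add, reTr_add]

omit [Fintype ι] in
theorem conjTranspose_signSum {N : ℕ} (ε : Fin N → Bool) (c : Fin N → Matrix ι ι ℂ) :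
    (signSum ε c)ᴴ = signSum ε (fun k => (c k)ᴴ) :=
  map_signSum (conjTransposeAddEquiv ι ι ℂ) ε c

theorem reTr_mul_sq_add_conjTranspose_le {S X : Matrix ι ι ℂ} (hS : S.PosSemidef) :
    reTr (S * ((X + Xᴴ) * (X + Xᴴ))) ≤ 2 * (reTr (S * (X * Xᴴ)) + reTr (S * (Xᴴ * X))) := by
  have h := reTr_mul_nonneg hS (posSemidef_self_mul_conjTranspose (X - Xᴴ))
  have h' : reTr (S * ((X - Xᴴ) * (X - Xᴴ)ᴴ)) = 
      reTr (S * (X * Xᴴ)) + reTr (S * (Xᴴ * X)) - reTr (S * (X * X)) - reTr (S * (Xᴴ * Xᴴ)) := by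
    rw [← reTr_add, ← reTr_sub, ← reTr_sub]
    congr 1
    rw [conjTranspose_sub, conjTranspose_conjTranspose]
    noncomm_ring
  have e : reTr (S * ((X + Xᴴ) * (X + Xᴴ))) =
      reTr (S * (X * Xᴴ)) + reTr (S * (Xᴴ * X)) + reTr (S * (X * X)) + reTr (S * (Xᴴ * Xᴴ)) := by
    rw [← reTr_add, ← reTr_add, ← reTr_add]
    congr 1
    noncomm_ring
  linarith

theorem signAvg_quartic_le {S : Matrix ι ι ℂ} (hS : S.PosSemidef) {N : ℕ}
    (c : Fin N → Matrix ι ι ℂ) :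
    signAvg (fun ε => reTr (S * (((signSum ε c)ᴴ * signSum ε c) *
        ((signSum ε c)ᴴ * signSum ε c)))) ≤
      reTr (S * ((∑ k, (c k)ᴴ * c k) * ∑ k, (c k)ᴴ * c k)) +
        2 * ∑ j, reTr (S * ((c j)ᴴ * (∑ k, c k * (c k)ᴴ) * c j)) := by
  induction N with
  | zero => simp [signAvg, signSum]
  | succ N ih =>
    set c' : Fin N → Matrix ι ι ℂ := fun k => c k.succ with hc'
    set d := c 0 with hd
    set A' := ∑ k, (c' k)ᴴ * c' k with hA'
    set B' := ∑ k, c' k * (c' k)ᴴ with hB'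
    have hA : ∑ k, (c k)ᴴ * c k = dᴴ * d + A' := Fin.sum_univ_succ _
    have hB : ∑ k, c k * (c k)ᴴ = d * dᴴ + B' := Fin.sum_univ_succ _
    have hpt : ∀ ε : Fin N → Bool,
        reTr (S * (((signSum (Fin.cons true ε) c)ᴴ * signSum (Fin.cons true ε) c) *
          ((signSum (Fin.cons true ε) c)ᴴ * signSum (Fin.cons true ε) c))) +
        reTr (S * (((signSum (Fin.cons false ε) c)ᴴ * signSum (Fin.cons false ε) c) *
          ((signSum (Fin.cons false ε) c)ᴴ * signSum (Fin.cons false ε) c))) ≤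
        2 * (reTr (S * (((signSum ε c')ᴴ * signSum ε c') * ((signSum ε c')ᴴ * signSum ε c'))) +
          (reTr (S * ((signSum ε c')ᴴ * signSum ε c' * (dᴴ * d))) +
          (reTr (S * (dᴴ * d * ((signSum ε c')ᴴ * signSum ε c'))) +
          (reTr (S * (dᴴ * d * (dᴴ * d))) +
          (2 * reTr (S * ((signSum ε c')ᴴ * (d * dᴴ) * signSum ε c')) +
          2 * reTr (S * (dᴴ * (signSum ε c' * (signSum ε c')ᴴ) * d))))))) := by
      intro ε
      rw [signSum_cons_true, signSum_cons_false]
      change reTr (S * (((signSum ε c' + d)ᴴ * (signSum ε c' + d)) *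
          ((signSum ε c' + d)ᴴ * (signSum ε c' + d)))) +
        reTr (S * (((signSum ε c' - d)ᴴ * (signSum ε c' - d)) *
          ((signSum ε c' - d)ᴴ * (signSum ε c' - d)))) ≤ _
      generalize signSum ε c' = C
      have h := reTr_mul_sq_add_conjTranspose_le (X := Cᴴ * d) hS
      have e : reTr (S * (((C + d)ᴴ * (C + d)) * ((C + d)ᴴ * (C + d)))) +
          reTr (S * (((C - d)ᴴ * (C - d)) * ((C - d)ᴴ * (C - d)))) =
          2 * (reTr (S * ((Cᴴ * C + dᴴ * d) * (Cᴴ * C + dᴴ * d))) +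
            reTr (S * ((Cᴴ * d + (Cᴴ * d)ᴴ) * (Cᴴ * d + (Cᴴ * d)ᴴ)))) := by
        rw [two_mul, ← reTr_add, ← reTr_add, ← reTr_add]
        congr 1
        simp only [conjTranspose_add, conjTranspose_sub, conjTranspose_mul,
          conjTranspose_conjTranspose]
        noncomm_ring
      have e2 : reTr (S * ((Cᴴ * C + dᴴ * d) * (Cᴴ * C + dᴴ * d))) =
          reTr (S * (Cᴴ * C * (Cᴴ * C))) + (reTr (S * (Cᴴ * C * (dᴴ * d))) +
            (reTr (S * (dᴴ * d * (Cᴴ * C))) + reTr (S * (dᴴ * d * (dᴴ * d))))) := by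
        rw [← reTr_add, ← reTr_add, ← reTr_add]
        congr 1
        noncomm_ring
      simp only [conjTranspose_mul, conjTranspose_conjTranspose] at h e
      have e3 : Cᴴ * d * (dᴴ * C) = Cᴴ * (d * dᴴ) * C := by simp only [Matrix.mul_assoc]
      have e4 : dᴴ * C * (Cᴴ * d) = dᴴ * (C * Cᴴ) * d := by simp only [Matrix.mul_assoc]
      rw [e3, e4] at h
      linarith
    rw [signAvg_succ]
    have hm := signAvg_mono hpt
    rw [signAvg_const_mul, signAvg_add, signAvg_add, signAvg_add, signAvg_add, signAvg_add, signAvg_add,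
      signAvg_const, signAvg_const_mul, signAvg_const_mul] at hm
    have a1 : signAvg (fun ε => reTr (S * ((signSum ε c')ᴴ * signSum ε c' * (dᴴ * d)))) =
        reTr (S * (A' * (dᴴ * d))) := by
      rw [signAvg_bilinear (fun a b => reTr (S * (aᴴ * b * (dᴴ * d))))
        (by intros; simp only [conjTranspose_add, Matrix.add_mul, Matrix.mul_add, reTr_add])
        (by intros; simp only [Matrix.add_mul, Matrix.mul_add, reTr_add])]
      rw [← reTr_sum, ← Finset.mul_sum, ← Finset.sum_mul]
    have a2 : signAvg (fun ε => reTr (S * (dᴴ * d * ((signSum ε c')ᴴ * signSum ε c')))) =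
        reTr (S * (dᴴ * d * A')) := by
      rw [signAvg_bilinear (fun a b => reTr (S * (dᴴ * d * (aᴴ * b))))
        (by intros; simp only [conjTranspose_add, Matrix.add_mul, Matrix.mul_add, reTr_add])
        (by intros; simp only [Matrix.mul_add, reTr_add])]
      rw [← reTr_sum, ← Finset.mul_sum, ← Finset.mul_sum]
    have a3 : signAvg (fun ε => reTr (S * ((signSum ε c')ᴴ * (d * dᴴ) * signSum ε c'))) =
        ∑ k, reTr (S * ((c' k)ᴴ * (d * dᴴ) * c' k)) :=
      signAvg_bilinear (fun a b => reTr (S * (aᴴ * (d * dᴴ) * b)))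
        (by intros; simp only [conjTranspose_add, Matrix.add_mul, Matrix.mul_add, reTr_add])
        (by intros; simp only [Matrix.mul_add, reTr_add]) c' c'
    have a4 : signAvg (fun ε => reTr (S * (dᴴ * (signSum ε c' * (signSum ε c')ᴴ) * d))) =
        reTr (S * (dᴴ * B' * d)) := by
      rw [signAvg_bilinear (fun a b => reTr (S * (dᴴ * (a * bᴴ) * d)))
        (by intros; simp only [Matrix.add_mul, Matrix.mul_add, reTr_add])
        (by intros; simp only [conjTranspose_add, Matrix.add_mul, Matrix.mul_add, reTr_add])]
      rw [← reTr_sum, ← Finset.mul_sum, ← Finset.sum_mul, ← Finset.mul_sum]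
    rw [a1, a2, a3, a4] at hm
    have hih := ih c'
    rw [hA, hB, Fin.sum_univ_succ]
    have e1 : reTr (S * ((dᴴ * d + A') * (dᴴ * d + A'))) = reTr (S * (A' * A')) +
        reTr (S * (A' * (dᴴ * d))) + reTr (S * (dᴴ * d * A')) + reTr (S * (dᴴ * d * (dᴴ * d))) := by
      rw [← reTr_add, ← reTr_add, ← reTr_add]
      congr 1
      noncomm_ring
    have e2 : ∀ x : Matrix ι ι ℂ, reTr (S * (xᴴ * (d * dᴴ + B') * x)) =
        reTr (S * (xᴴ * (d * dᴴ) * x)) + reTr (S * (xᴴ * B' * x)) := by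
      intro x
      rw [← reTr_add]
      congr 1
      noncomm_ring
    have e3 : 0 ≤ reTr (S * (dᴴ * (d * dᴴ) * d)) :=
      reTr_mul_nonneg hS ((posSemidef_self_mul_conjTranspose d).conjTranspose_mul_mul_same d)
    rw [e1, Finset.sum_congr rfl fun k _ => e2 (c (Fin.succ k)), e2, Finset.sum_add_distrib]
    change _ ≤ _ + 2 * (_ + (∑ k, reTr (S * ((c' k)ᴴ * (d * dᴴ) * c' k)) +
      ∑ k, reTr (S * ((c' k)ᴴ * B' * c' k))))
    change _ ≤ _ + 2 * (reTr (S * (dᴴ * (d * dᴴ) * d)) + reTr (S * (dᴴ * B' * d)) + _)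
    linarith

variable [DecidableEq ι]

theorem posSemidef_sub_mul_self {A : Matrix ι ι ℂ} (hA : A.PosSemidef)
    (h1 : (1 - A).PosSemidef) : (A - A * A).PosSemidef := by
  have e : A - A * A = A * (1 - A) * Aᴴ + (1 - A) * A * (1 - A)ᴴ := by
    rw [conjTranspose_sub, conjTranspose_one, hA.1.eq]
    noncomm_ring
  rw [e]
  exact (h1.mul_mul_conjTranspose_same _).add (hA.mul_mul_conjTranspose_same _)

theorem signAvg_quartic_le_of_le_one {S : Matrix ι ι ℂ} (hS : S.PosSemidef) {N : ℕ}
    {c : Fin N → Matrix ι ι ℂ} (hA : (1 - ∑ k, (c k)ᴴ * c k).PosSemidef)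
    (hB : (1 - ∑ k, c k * (c k)ᴴ).PosSemidef) :
    signAvg (fun ε => reTr (S * (((signSum ε c)ᴴ * signSum ε c) *
        ((signSum ε c)ᴴ * signSum ε c)))) ≤ 3 * reTr S := by
  refine (signAvg_quartic_le hS c).trans ?_
  have hA0 : (∑ k, (c k)ᴴ * c k).PosSemidef :=
    posSemidef_sum _ fun k _ => posSemidef_conjTranspose_mul_self _
  have h1 := reTr_mul_le_mul hS (posSemidef_sub_mul_self hA0 hA)
  have h2 := reTr_mul_le_mul hS hA
  rw [Matrix.mul_one] at h2
  have h3 : ∑ j, reTr (S * ((c j)ᴴ * (∑ k, c k * (c k)ᴴ) * c j)) ≤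
      reTr (S * ∑ k, (c k)ᴴ * c k) := by
    rw [Finset.mul_sum, reTr_sum]
    refine Finset.sum_le_sum fun j _ => reTr_mul_le_mul hS ?_
    have := hB.conjTranspose_mul_mul_same (c j)
    rwa [Matrix.mul_sub, Matrix.sub_mul, Matrix.mul_one] at this
  linarith

/-- A smooth truncation of `C` to a contraction. -/
theorem exists_contraction (C : Matrix ι ι ℂ) {S T : Matrix ι ι ℂ} (hS : S.PosSemidef)
    (hT : T.PosSemidef) :
    ∃ V : Matrix ι ι ℂ, (1 - Vᴴ * V).PosSemidef ∧
      reTr ((C - V)ᴴ * (C * S + T * C)) ≤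
        1 / 4 * (reTr (S * ((Cᴴ * C) * (Cᴴ * C))) + reTr (T * ((C * Cᴴ) * (C * Cᴴ)))) := by
  set Q := ((1 / 4 : ℝ) : ℂ) • (Cᴴ * C) with hQdef
  have hQ : Q.PosSemidef := (posSemidef_conjTranspose_mul_self C).smul (by
    rw [Complex.zero_le_real]; norm_num)
  have hCC : Cᴴ * C = (4 : ℂ) • Q := by
    rw [hQdef, smul_smul]; norm_num
  have h1Q : (1 + Q).PosDef := PosDef.one.add_posSemidef hQ
  have hu : IsUnit (1 + Q).det := (Matrix.isUnit_iff_isUnit_det _).1 h1Q.isUnit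
  set R := (1 + Q)⁻¹ with hR
  have hRQ : R * Q = 1 - R := by
    have := Matrix.nonsing_inv_mul _ hu
    rw [Matrix.mul_add, Matrix.mul_one] at this
    rw [← this]; abel
  have hQR : Q * R = 1 - R := by
    have := Matrix.mul_nonsing_inv _ hu
    rw [Matrix.add_mul, Matrix.one_mul] at this
    rw [← this]; abel
  have hRh : Rᴴ = R := h1Q.inv.1.eq
  have hR1 : (1 - R).PosSemidef := by
    have e : 1 - R = R * Q * Rᴴ + (Q * R)ᴴ * (Q * R) := by
      rw [hRh, conjTranspose_mul, hRh, hQ.1.eq, hRQ, hQR]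
      noncomm_ring
    rw [e]
    exact (hQ.mul_mul_conjTranspose_same _).add (posSemidef_conjTranspose_mul_self _)
  refine ⟨C * R, ?_, ?_⟩
  · have e : 1 - (C * R)ᴴ * (C * R) = ((1 - Q) * R)ᴴ * ((1 - Q) * R) := by
      have e1 : (C * R)ᴴ * (C * R) = R * (Cᴴ * C) * R := by
        rw [conjTranspose_mul, hRh]; simp only [Matrix.mul_assoc]
      have e2 : R * ((4 : ℂ) • Q) * R = (4 : ℂ) • ((1 - R) * R) := by
        rw [Matrix.mul_smul, hRQ, Matrix.smul_mul]
      rw [e1, hCC, e2, conjTranspose_mul, conjTranspose_sub, conjTranspose_one, hRh, hQ.1.eq,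
        Matrix.mul_sub, Matrix.mul_one, hRQ, Matrix.sub_mul 1 Q R, Matrix.one_mul, hQR]
      simp only [Matrix.sub_mul, Matrix.mul_sub, Matrix.one_mul, Matrix.mul_one]
      module
    rw [e]
    exact posSemidef_conjTranspose_mul_self _
  · have e : (C - C * R)ᴴ * (C * S + T * C) =
        (1 - R) * (Cᴴ * C) * S + (1 - R) * Cᴴ * T * C := by
      rw [conjTranspose_sub, conjTranspose_mul, hRh]
      noncomm_ring
    have f1 : reTr ((1 - R) * (Cᴴ * C) * S) ≤ 1 / 4 * reTr (S * ((Cᴴ * C) * (Cᴴ * C))) := by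
      have e1 : (1 - R) * (Cᴴ * C) * S = (((4 : ℝ)) : ℂ) • ((1 - R) * Q * S) := by
        rw [hCC]; simp
      have e2 : S * ((Cᴴ * C) * (Cᴴ * C)) = ((16 : ℝ) : ℂ) • (S * (Q * Q)) := by
        rw [hCC]; simp only [Matrix.smul_mul, Matrix.mul_smul, smul_smul]; norm_num
      rw [e1, e2, reTr_smul, reTr_smul, reTr_mul_comm]
      have h := reTr_mul_nonneg hS (hR1.mul_mul_conjTranspose_same Q)
      rw [hQ.1.eq] at h
      have e3 : Q * (1 - R) * Q = Q * Q - (1 - R) * Q := by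
        rw [Matrix.mul_sub, Matrix.mul_one, hQR, Matrix.sub_mul]
      rw [e3, Matrix.mul_sub, reTr_sub] at h
      linarith
    have f2 : reTr ((1 - R) * Cᴴ * T * C) ≤ 1 / 4 * reTr (T * ((C * Cᴴ) * (C * Cᴴ))) := by
      have e1 : reTr ((1 - R) * Cᴴ * T * C) = reTr (T * (C * (1 - R) * Cᴴ)) := by
        rw [Matrix.mul_assoc, reTr_mul_comm, Matrix.mul_assoc, ← Matrix.mul_assoc C]
      have e2 : T * ((C * Cᴴ) * (C * Cᴴ)) = ((4 : ℝ) : ℂ) • (T * (C * Q * Cᴴ)) := by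
        have : C * Cᴴ * (C * Cᴴ) = C * (Cᴴ * C) * Cᴴ := by simp only [Matrix.mul_assoc]
        rw [this, hCC]; simp
      rw [e1, e2, reTr_smul]
      have h : (C * Q * Cᴴ - C * (1 - R) * Cᴴ).PosSemidef := by
        have e3 : C * Q * Cᴴ - C * (1 - R) * Cᴴ = C * (Q * R * Qᴴ) * Cᴴ := by
          rw [hQR, hQ.1.eq, Matrix.sub_mul, Matrix.one_mul, hRQ]
          noncomm_ring
        rw [e3]
        exact (h1Q.inv.posSemidef.mul_mul_conjTranspose_same Q).mul_mul_conjTranspose_same C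
      have := reTr_mul_le_mul hT h
      linarith
    rw [e, reTr_add]
    linarith

/-- Testing random sums against contractions bounds the sum of the traces from below. -/
theorem exists_contraction_signAvg {N : ℕ} {c z : Fin N → Matrix ι ι ℂ} {S T : Matrix ι ι ℂ}
    (hS : S.PosSemidef) (hT : T.PosSemidef) (hz : ∀ k, z k = c k * S + T * c k)
    (hA : (1 - ∑ k, (c k)ᴴ * c k).PosSemidef) (hB : (1 - ∑ k, c k * (c k)ᴴ).PosSemidef) {η : ℝ}
    (h : reTr S + reTr T - η ≤ ∑ k, reTr ((c k)ᴴ * z k)) :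
    ∃ V : (Fin N → Bool) → Matrix ι ι ℂ, (∀ ε, (1 - (V ε)ᴴ * V ε).PosSemidef) ∧
      (reTr S + reTr T) / 4 - η ≤ signAvg (fun ε => reTr ((V ε)ᴴ * signSum ε z)) := by
  choose V hV1 hV2 using fun ε : Fin N → Bool => exists_contraction (signSum ε c) hS hT
  refine ⟨V, hV1, ?_⟩
  have hZ : ∀ ε, signSum ε c * S + T * signSum ε c = signSum ε z := by
    intro ε
    simp only [signSum, Finset.sum_mul, Finset.mul_sum, ← Finset.sum_add_distrib]
    refine Finset.sum_congr rfl fun k _ => ?_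
    rw [hz]
    split_ifs
    · rfl
    · noncomm_ring
  have h1 : signAvg (fun ε => reTr ((signSum ε c)ᴴ * signSum ε z)) =
      ∑ k, reTr ((c k)ᴴ * z k) := by
    refine signAvg_bilinear (fun a b => reTr (aᴴ * b)) ?_ ?_ c z
    · intro x y z; rw [conjTranspose_add, Matrix.add_mul, reTr_add]
    · intro x y z; rw [Matrix.mul_add, reTr_add]
  have h2 := signAvg_mono hV2
  rw [signAvg_const_mul, signAvg_add] at h2
  have h3 := signAvg_quartic_le_of_le_one hS hA hB
  have h4 := signAvg_quartic_le_of_le_one (c := fun k => (c k)ᴴ) hT (by simpa using hB)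
    (by simpa using hA)
  simp only [← conjTranspose_signSum, conjTranspose_conjTranspose] at h4
  have h5 : signAvg (fun ε => reTr ((signSum ε c)ᴴ * signSum ε z)) =
      signAvg (fun ε => reTr ((V ε)ᴴ * signSum ε z)) +
      signAvg (fun ε => reTr ((signSum ε c - V ε)ᴴ * (signSum ε c * S + T * signSum ε c))) := by
    rw [← signAvg_add]
    congr 1
    funext ε
    rw [hZ, ← reTr_add, ← Matrix.add_mul, ← conjTranspose_add]
    congr 3
    abel
  linarith

end Khintchine

section JordanProduct

variable {ι κ : Type*} [Fintype ι] [DecidableEq ι] [Fintype κ]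

theorem rpow_mul_rpow_le_add {x y a b : ℝ} (hx : 0 < x) (hy : 0 < y) (ha : 0 ≤ a) (hb : 0 ≤ b) :
    x ^ a * y ^ b ≤ x ^ (a + b) + y ^ (a + b) := by
  rcases le_total x y with h | h
  · have h1 : x ^ a * y ^ b ≤ y ^ a * y ^ b := by gcongr
    rw [← Real.rpow_add hy] at h1
    have := Real.rpow_nonneg hx.le (a + b)
    linarith
  · have h1 : x ^ a * y ^ b ≤ x ^ a * x ^ b := by gcongr
    rw [← Real.rpow_add hx] at h1
    have := Real.rpow_nonneg hy.le (a + b)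
    linarith

theorem eigenvectorUnitary_conjTranspose_mul {h : Matrix ι ι ℂ} (hh : h.IsHermitian) :
    (hh.eigenvectorUnitary : Matrix ι ι ℂ)ᴴ * hh.eigenvectorUnitary = 1 :=
  Unitary.coe_star_mul_self hh.eigenvectorUnitary

theorem eigenvectorUnitary_mul_conjTranspose {h : Matrix ι ι ℂ} (hh : h.IsHermitian) :
    (hh.eigenvectorUnitary : Matrix ι ι ℂ) * (hh.eigenvectorUnitary : Matrix ι ι ℂ)ᴴ = 1 :=
  Unitary.coe_mul_star_self hh.eigenvectorUnitary

/-- The Jordan multiplication by `h ^ (a + b)` can be inverted on `h ^ a * X * h ^ b`. -/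
theorem exists_jordan_inverse {h : Matrix ι ι ℂ} (hh : h.PosDef) {a b : ℝ} (ha : 0 ≤ a)
    (hb : 0 ≤ b) (X : Matrix ι ι ℂ) :
    ∃ y : Matrix ι ι ℂ, posPow h a * X * posPow h b =
      (1 / 2 : ℂ) • (posPow h (a + b) * y + y * posPow h (a + b)) ∧ frob y ≤ 4 * frob X := by
  set U := (hh.1.eigenvectorUnitary : Matrix ι ι ℂ)
  have hU : Uᴴ * U = 1 := eigenvectorUnitary_conjTranspose_mul hh.1
  have hU' : U * Uᴴ = 1 := eigenvectorUnitary_mul_conjTranspose hh.1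
  set η := hh.1.eigenvalues
  have hη : ∀ i, 0 < η i := fun i => hh.eigenvalues_pos i
  have hpow : ∀ s, posPow h s = U * diagonal (fun i => ((η i ^ s : ℝ) : ℂ)) * Uᴴ :=
    posPow_eq_unitary hh.1
  set X' := Uᴴ * X * U with hX'
  set y' : Matrix ι ι ℂ := Matrix.of fun i j =>
    ((2 * (η i ^ a * η j ^ b) / (η i ^ (a + b) + η j ^ (a + b)) : ℝ) : ℂ) * X' i j with hy'
  have hX : X = U * X' * Uᴴ := by
    rw [hX', ← Matrix.mul_assoc, ← Matrix.mul_assoc, hU', Matrix.one_mul, Matrix.mul_assoc, hU',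
      Matrix.mul_one]
  have hconj : ∀ A B : Matrix ι ι ℂ, U * A * Uᴴ * (U * B * Uᴴ) = U * (A * B) * Uᴴ := by
    intro A B
    calc U * A * Uᴴ * (U * B * Uᴴ) = U * A * (Uᴴ * U) * B * Uᴴ := by simp only [Matrix.mul_assoc]
      _ = _ := by rw [hU, Matrix.mul_one]; simp only [Matrix.mul_assoc]
  refine ⟨U * y' * Uᴴ, ?_, ?_⟩
  · rw [hpow, hpow, hpow, hX, hconj, hconj, hconj, hconj, ← Matrix.add_mul, ← Matrix.mul_add,
      ← Matrix.smul_mul, ← Matrix.mul_smul]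
    congr 2
    ext i j
    have hpos : η i ^ (a + b) + η j ^ (a + b) ≠ 0 := by
      have := Real.rpow_pos_of_pos (hη i) (a + b)
      have := Real.rpow_pos_of_pos (hη j) (a + b)
      positivity
    have hpos' : ((η i ^ (a + b) : ℝ) : ℂ) + ((η j ^ (a + b) : ℝ) : ℂ) ≠ 0 := by
      exact_mod_cast hpos
    simp only [Matrix.mul_diagonal, Matrix.diagonal_mul, Matrix.smul_apply, Matrix.add_apply, hy',
      Matrix.of_apply, smul_eq_mul]
    push_cast
    field_simp
  · rw [frob_mul_unitary (by rw [conjTranspose_conjTranspose, hU]), frob_unitary_mul hU, hX,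
      frob_mul_unitary (by rw [conjTranspose_conjTranspose, hU]), frob_unitary_mul hU]
    have h2 : (4 : ℝ) * frob X' = frob ((2 : ℂ) • X') := by
      rw [frob_smul]; norm_num
    rw [h2]
    refine frob_le_frob fun i j => ?_
    have h3 := rpow_mul_rpow_le_add (hη i) (hη j) ha hb
    have hi := Real.rpow_pos_of_pos (hη i) (a + b)
    have hj := Real.rpow_pos_of_pos (hη j) (a + b)
    have hi' := Real.rpow_pos_of_pos (hη i) a
    have hj' := Real.rpow_pos_of_pos (hη j) b
    simp only [hy', Matrix.of_apply, Matrix.smul_apply, smul_eq_mul, norm_mul, Complex.norm_real,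
      Complex.norm_ofNat]
    refine mul_le_mul_of_nonneg_right ?_ (norm_nonneg _)
    rw [Real.norm_of_nonneg (by positivity), div_le_iff₀ (by positivity)]
    linarith

theorem sum_frob_mul_le {T K : Matrix ι ι ℂ} {c : κ → Matrix ι ι ℂ} {τ : ℝ} (hT : T.PosDef)
    (hK : ((τ : ℂ) • T⁻¹ - Kᴴ * K).PosSemidef) (hc : (1 - ∑ k, c k * (c k)ᴴ).PosSemidef) :
    ∑ k, frob (K * T * c k) ≤ τ * reTr T := by
  have hTu : IsUnit T.det := (Matrix.isUnit_iff_isUnit_det T).1 hT.isUnit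
  have e : ∀ k, frob (K * T * c k) = reTr ((K * T)ᴴ * (K * T) * (c k * (c k)ᴴ)) := by
    intro k
    rw [frob, conjTranspose_mul _ (c k), Matrix.mul_assoc, reTr_mul_comm]
    simp only [Matrix.mul_assoc]
  rw [Finset.sum_congr rfl fun k _ => e k, ← reTr_sum, ← Finset.mul_sum]
  have h1 := reTr_mul_le_mul (posSemidef_conjTranspose_mul_self (K * T)) hc
  have h2 := reTr_mono (A := (K * T)ᴴ * (K * T)) (B := (τ : ℂ) • T) (by
    have := hK.conjTranspose_mul_mul_same T
    have e : (τ : ℂ) • T - (K * T)ᴴ * (K * T) = Tᴴ * ((τ : ℂ) • T⁻¹ - Kᴴ * K) * T := by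
      rw [Matrix.mul_sub, Matrix.sub_mul, conjTranspose_mul, Matrix.mul_smul, hT.1.eq,
        Matrix.mul_nonsing_inv _ hTu, Matrix.smul_mul, Matrix.one_mul]
      simp only [Matrix.mul_assoc]
    rwa [e])
  rw [Matrix.mul_one] at h1
  rw [reTr_smul] at h2
  linarith

theorem sum_frob_mul_mul_le {S L E : Matrix ι ι ℂ} {c : κ → Matrix ι ι ℂ} {τ : ℝ} (hS : S.PosDef)
    (hL : (1 - Lᴴ * L).PosSemidef) (hE : ((τ : ℂ) • S⁻¹ - E * Eᴴ).PosSemidef)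
    (hc : (1 - ∑ k, (c k)ᴴ * c k).PosSemidef) :
    ∑ k, frob (L * c k * S * E) ≤ τ * reTr S := by
  have h1 : ∀ k, frob (L * c k * S * E) ≤ frob (Eᴴ * S * (c k)ᴴ) := by
    intro k
    rw [← frob_conjTranspose (Eᴴ * S * (c k)ᴴ)]
    simp only [conjTranspose_mul, conjTranspose_conjTranspose, hS.1.eq]
    refine reTr_mono ?_
    have := hL.conjTranspose_mul_mul_same (c k * (S * E))
    rw [Matrix.mul_sub, Matrix.sub_mul, Matrix.mul_one] at this
    convert! this using 1
    simp only [conjTranspose_mul, Matrix.mul_assoc]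
  refine (Finset.sum_le_sum fun k _ => h1 k).trans ?_
  exact sum_frob_mul_le (c := fun k => (c k)ᴴ) hS (by simpa using hE) (by simpa using hc)

/-- The data attached to a density matrix, dominating the two sides of a decomposition. -/
theorem exists_dominating_matrix [Nonempty ι] {f S T : Matrix ι ι ℂ} (hf : f.PosDef)
    (hf1 : reTr f = 1) (hS : S.PosDef) (hT : T.PosDef) {β : ℝ} (hβ : 0 < β) :
    ∃ h : Matrix ι ι ℂ, h.PosDef ∧ 0 < reTr h ∧ reTr h ≤ 3 ∧
      (((reTr S + reTr T : ℝ) : ℂ) • S⁻¹ - (posPow h (-(β + 1 / 2)) * posPow f β)ᴴ *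
        (posPow h (-(β + 1 / 2)) * posPow f β)).PosSemidef ∧
      (((reTr S + reTr T : ℝ) : ℂ) • T⁻¹ - (posPow h (-(β + 1 / 2)) * posPow f β)ᴴ *
        (posPow h (-(β + 1 / 2)) * posPow f β)).PosSemidef ∧
      (1 - (posPow h (-β) * posPow f β)ᴴ * (posPow h (-β) * posPow f β)).PosSemidef ∧
      (((reTr S + reTr T : ℝ) : ℂ) • S⁻¹ - posPow h (-(1 / 2)) *
        (posPow h (-(1 / 2)))ᴴ).PosSemidef ∧
      (((reTr S + reTr T : ℝ) : ℂ) • T⁻¹ - posPow h (-(1 / 2)) *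
        (posPow h (-(1 / 2)))ᴴ).PosSemidef := by
  have hpos : ∀ {A : Matrix ι ι ℂ}, A.PosDef → 0 < reTr A := fun hA =>
    (Complex.lt_def.1 hA.trace_pos).1
  set τ := reTr S + reTr T with hτ
  have hτ0 : 0 < τ := add_pos (hpos hS) (hpos hT)
  have hτc : (0 : ℂ) < ((τ⁻¹ : ℝ) : ℂ) := by exact_mod_cast inv_pos.2 hτ0
  set G : Matrix ι ι ℂ := ((τ⁻¹ : ℝ) : ℂ) • (S + T) with hGdef
  have hG : G.PosDef := (hS.add hT).smul hτc
  have hG1 : reTr G = 1 := by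
    rw [hGdef, reTr_smul, reTr_add, ← hτ, inv_mul_cancel₀ hτ0.ne']
  have hq : 0 < 2 * β + 1 := by linarith
  set F := posPow f β with hF
  have hFp : F.PosDef := posPow_posDef hf β
  have hconj : ∀ {A : Matrix ι ι ℂ}, A.PosSemidef → (F * A * F).PosSemidef := by
    intro A hA
    have := hA.mul_mul_conjTranspose_same F
    rwa [hFp.1.eq] at this
  have hFGF : (F * G * F).PosDef := by
    have := (Matrix.IsUnit.posDef_star_right_conjugate_iff hFp.isUnit).2 hG
    rwa [Matrix.star_eq_conjTranspose, hFp.1.eq] at this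
  have hf2 := posPow_posDef hf (2 * β + 1)
  have hG2 := posPow_posDef hG (2 * β + 1)
  set H := posPow f (2 * β + 1) + posPow G (2 * β + 1) + F * G * F with hHdef
  have hH : H.PosDef := (hf2.add hG2).add hFGF
  set r := 1 / (2 * β + 1) with hr
  have hr0 : 0 < r := by positivity
  have hr1 : r < 1 := by rw [hr, div_lt_one hq]; linarith
  have hrq : (2 * β + 1) * r = 1 := by rw [hr]; field_simp
  set h := posPow H r with hh
  have hhp : h.PosDef := posPow_posDef hH r
  have hpow : ∀ s, posPow h s = posPow H (r * s) := fun s => posPow_posPow hH r s hr0.ne'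
  have htr : reTr h ≤ 3 := by
    have h1 := reTr_posPow_add_le (hf2.add hG2) hFGF hr0 hr1
    have h2 := reTr_posPow_add_le hf2 hG2 hr0 hr1
    have h3 := reTr_posPow_conj_le_one hf hG hf1 hG1 hβ
    rw [posPow_posPow hf _ _ hq.ne', posPow_posPow hG _ _ hq.ne', hrq, posPow_one hf.posSemidef,
      posPow_one hG.posSemidef, hf1, hG1] at h2
    linarith
  have hGS : (G - ((τ⁻¹ : ℝ) : ℂ) • S).PosSemidef := by
    rw [hGdef, smul_add, add_sub_cancel_left]
    exact (hT.smul hτc).posSemidef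
  have hGT : (G - ((τ⁻¹ : ℝ) : ℂ) • T).PosSemidef := by
    rw [hGdef, smul_add, add_sub_cancel_right]
    exact (hS.smul hτc).posSemidef
  have hinv : ∀ {A : Matrix ι ι ℂ}, A.PosDef →
      (((τ⁻¹ : ℝ) : ℂ) • A)⁻¹ = (τ : ℂ) • A⁻¹ := by
    intro A hA
    have hAu : IsUnit A.det := (Matrix.isUnit_iff_isUnit_det A).1 hA.isUnit
    refine Matrix.inv_eq_right_inv ?_
    rw [Matrix.smul_mul, Matrix.mul_smul, smul_smul, Matrix.mul_nonsing_inv _ hAu,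
      ← Complex.ofReal_mul, inv_mul_cancel₀ hτ0.ne', Complex.ofReal_one, one_smul]
  have hh1 : ∀ s, (posPow h s)ᴴ = posPow h s := fun s => (posPow_posDef hhp s).1.eq
  have first : ∀ {A : Matrix ι ι ℂ}, A.PosDef → (G - ((τ⁻¹ : ℝ) : ℂ) • A).PosSemidef →
      ((τ : ℂ) • A⁻¹ - (posPow h (-(β + 1 / 2)) * F)ᴴ *
        (posPow h (-(β + 1 / 2)) * F)).PosSemidef := by
    intro A hA hGA
    have e : (posPow h (-(β + 1 / 2)) * F)ᴴ * (posPow h (-(β + 1 / 2)) * F) = Fᴴ * H⁻¹ * F := by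
      have e1 : posPow h (-(β + 1 / 2)) * posPow h (-(β + 1 / 2)) = H⁻¹ := by
        rw [posPow_mul_posPow hhp, hpow]
        have : r * (-(β + 1 / 2) + -(β + 1 / 2)) = -1 := by linarith
        rw [this, posPow_neg_eq_inv hH, posPow_one hH.posSemidef]
      rw [conjTranspose_mul, hh1, ← e1]
      simp only [Matrix.mul_assoc]
    rw [e, ← hinv hA]
    refine posSemidef_inv_sub_of_posSemidef_sub (hA.smul hτc) hH ?_
    have e2 : H - F * (((τ⁻¹ : ℝ) : ℂ) • A) * Fᴴ = posPow f (2 * β + 1) + posPow G (2 * β + 1) +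
        F * (G - ((τ⁻¹ : ℝ) : ℂ) • A) * F := by
      rw [hHdef, hFp.1.eq, Matrix.mul_sub, Matrix.sub_mul]
      abel
    rw [e2]
    exact (hf2.posSemidef.add hG2.posSemidef).add (hconj hGA)
  have hhG : (h - G).PosSemidef := by
    have := posPow_le_posPow (r := r) hG2 hH (by
      have e : H - posPow G (2 * β + 1) = posPow f (2 * β + 1) + F * G * F := by
        rw [hHdef]; abel
      rw [e]
      exact hf2.posSemidef.add hFGF.posSemidef) hr0.le hr1.le
    rwa [posPow_posPow hG _ _ hq.ne', hrq, posPow_one hG.posSemidef] at this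
  have third : ∀ {A : Matrix ι ι ℂ}, A.PosDef → (G - ((τ⁻¹ : ℝ) : ℂ) • A).PosSemidef →
      ((τ : ℂ) • A⁻¹ - posPow h (-(1 / 2)) * (posPow h (-(1 / 2)))ᴴ).PosSemidef := by
    intro A hA hGA
    have e1 : posPow h (-(1 / 2)) * (posPow h (-(1 / 2)))ᴴ = h⁻¹ := by
      rw [hh1, posPow_mul_posPow hhp]
      have : (-(1 / 2) + -(1 / 2) : ℝ) = -1 := by norm_num
      rw [this, posPow_neg_eq_inv hhp, posPow_one hhp.posSemidef]
    rw [e1, ← hinv hA]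
    refine posSemidef_inv_sub_inv (hA.smul hτc) hhp ?_
    have := hhG.add hGA
    rwa [sub_add_sub_cancel] at this
  refine ⟨h, hhp, hpos hhp, htr, first hS hGS, first hT hGT, ?_, third hS hGS, third hT hGT⟩
  have hs0 : 0 ≤ r * (2 * β) := by positivity
  have hs1 : r * (2 * β) ≤ 1 := by linarith
  have h1 := posPow_le_posPow (r := r * (2 * β)) hf2 hH (by
    have e : H - posPow f (2 * β + 1) = posPow G (2 * β + 1) + F * G * F := by
      rw [hHdef]; abel
    rw [e]
    exact hG2.posSemidef.add hFGF.posSemidef) hs0 hs1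
  rw [posPow_posPow hf _ _ hq.ne', ← hpow, ← mul_assoc, hrq, one_mul, two_mul,
    ← posPow_mul_posPow hf, ← hF] at h1
  have h2 := posSemidef_inv_sub_of_posSemidef_sub (X := F) PosDef.one
    (posPow_posDef hhp (β + β)) (by rwa [Matrix.mul_one, hFp.1.eq])
  rw [inv_one, ← posPow_neg_eq_inv hhp, neg_add, ← posPow_mul_posPow hhp] at h2
  convert! h2 using 2
  rw [conjTranspose_mul, hh1]
  simp only [Matrix.mul_assoc]

omit [DecidableEq ι] in
theorem frob_add_four_le (a b c d : Matrix ι ι ℂ) :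
    frob (a + b + c + d) ≤ 4 * (frob a + frob b + frob c + frob d) := by
  have h1 := frob_add_le (a + b) (c + d)
  have h2 := frob_add_le a b
  have h3 := frob_add_le c d
  rw [← add_assoc] at h1
  linarith

/-- A density matrix adapted to a decomposition `c * S + T * c`. -/
theorem exists_density_of_decomposition [Nonempty ι] {f S T : Matrix ι ι ℂ} (hf : f.PosDef)
    (hf1 : reTr f = 1) (hS : S.PosDef) (hT : T.PosDef) {β : ℝ} (hβ : 0 < β)
    {c : κ → Matrix ι ι ℂ} (hA : (1 - ∑ k, (c k)ᴴ * c k).PosSemidef)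
    (hB : (1 - ∑ k, c k * (c k)ᴴ).PosSemidef) :
    ∃ h : Matrix ι ι ℂ, h.PosDef ∧ reTr h = 1 ∧ ∃ y : κ → Matrix ι ι ℂ,
      (∀ k, (1 / 2 : ℂ) • (posPow f β * (c k * S + T * c k) + (c k * S + T * c k) * posPow f β) =
        (1 / 2 : ℂ) • (posPow h (β + 1 / 2) * y k + y k * posPow h (β + 1 / 2))) ∧
      ∑ k, frob (y k) ≤ 8 * 3 ^ (2 * β + 1) * (reTr S + reTr T) ^ 2 := by
  obtain ⟨h, hh, ht0, ht3, b1, b2, b3, b4, b5⟩ := exists_dominating_matrix hf hf1 hS hT hβ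
  set τ := reTr S + reTr T with hτ
  set F := posPow f β with hF
  have hFh : Fᴴ = F := (posPow_posDef hf β).1.eq
  have hhh : ∀ s, (posPow h s)ᴴ = posPow h s := fun s => (posPow_posDef hh s).1.eq
  have cancel : ∀ s (A : Matrix ι ι ℂ), posPow h s * (posPow h (-s) * A) = A := by
    intro s A
    rw [← Matrix.mul_assoc, posPow_mul_neg_self hh, Matrix.one_mul]
  have c1 := sum_frob_mul_le hT b2 hB
  have c2 := sum_frob_mul_mul_le hS b3 b4 hA
  have c3 := sum_frob_mul_le (c := fun k => (c k)ᴴ) hS b1 (by simpa using hA)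
  have c4 := sum_frob_mul_mul_le (c := fun k => (c k)ᴴ) hT b3 b5 (by simpa using hB)
  have hβ' : 0 ≤ β + 1 / 2 := by linarith
  choose y1 e1 f1 using fun k => exists_jordan_inverse hh hβ' le_rfl
    (posPow h (-(β + 1 / 2)) * F * T * c k)
  choose y2 e2 f2 using fun k => exists_jordan_inverse hh hβ.le (b := 1 / 2) (by norm_num)
    (posPow h (-β) * F * c k * S * posPow h (-(1 / 2)))
  choose y3 e3 f3 using fun k => exists_jordan_inverse hh le_rfl hβ'
    (posPow h (-(β + 1 / 2)) * F * S * (c k)ᴴ)ᴴ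
  choose y4 e4 f4 using fun k => exists_jordan_inverse hh (a := 1 / 2) (by norm_num) hβ.le
    (posPow h (-β) * F * (c k)ᴴ * T * posPow h (-(1 / 2)))ᴴ
  have cancel' : ∀ s, posPow h (-s) * posPow h s = 1 := posPow_neg_mul_self hh
  simp only [frob_conjTranspose] at f3 f4
  simp only [posPow_zero hh, Matrix.mul_one, Matrix.one_mul, add_zero, zero_add,
    conjTranspose_mul, conjTranspose_conjTranspose, hhh, hFh, hS.1.eq, hT.1.eq, Matrix.mul_assoc,
    cancel, cancel', add_comm (1 / 2 : ℝ) β] at e1 e2 e3 e4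
  set y0 : κ → Matrix ι ι ℂ := fun k => (1 / 2 : ℂ) • (y1 k + y2 k + y3 k + y4 k) with hy0
  have hy0s : ∑ k, frob (y0 k) ≤ 8 * τ ^ 2 := by
    have hk : ∀ k, frob (y0 k) ≤ 4 * frob (posPow h (-(β + 1 / 2)) * F * T * c k) +
        4 * frob (posPow h (-β) * F * c k * S * posPow h (-(1 / 2))) +
        4 * frob (posPow h (-(β + 1 / 2)) * F * S * (c k)ᴴ) +
        4 * frob (posPow h (-β) * F * (c k)ᴴ * T * posPow h (-(1 / 2))) := by
      intro k
      have h1 := frob_add_four_le (y1 k) (y2 k) (y3 k) (y4 k)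
      have h2 := f1 k
      have h3 := f2 k
      have h4 := f3 k
      have h5 := f4 k
      simp only [hy0]
      have hn : ‖(1 / 2 : ℂ)‖ ^ 2 = 1 / 4 := by norm_num
      rw [frob_smul, hn]
      linarith
    refine (Finset.sum_le_sum fun k _ => hk k).trans ?_
    simp only [Finset.sum_add_distrib, ← Finset.mul_sum]
    nlinarith
  set t := reTr h with ht
  set h' : Matrix ι ι ℂ := ((t⁻¹ : ℝ) : ℂ) • h with hh'
  have hti : 0 < t⁻¹ := inv_pos.2 ht0
  refine ⟨h', hh.smul (by exact_mod_cast hti), ?_,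
    fun k => ((t ^ (β + 1 / 2) : ℝ) : ℂ) • y0 k, fun k => ?_, ?_⟩
  · rw [hh', reTr_smul, ← ht, inv_mul_cancel₀ ht0.ne']
  · have e : (((t⁻¹) ^ (β + 1 / 2) : ℝ) : ℂ) * ((t ^ (β + 1 / 2) : ℝ) : ℂ) = 1 := by
      rw [← Complex.ofReal_mul, Real.inv_rpow ht0.le, inv_mul_cancel₀
        (Real.rpow_pos_of_pos ht0 _).ne', Complex.ofReal_one]
    rw [hh', posPow_smul hh hti]
    simp only [Matrix.smul_mul, Matrix.mul_smul, smul_smul]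
    rw [mul_comm ((t ^ (β + 1 / 2) : ℝ) : ℂ), e, one_smul, one_smul]
    congr 1
    have e5 : F * (c k * S + T * c k) + (c k * S + T * c k) * F =
        F * (T * c k) + F * (c k * S) + c k * (S * F) + T * (c k * F) := by
      noncomm_ring
    rw [e5, e1, e2, e3, e4]
    simp only [hy0, Matrix.mul_smul, Matrix.smul_mul, Matrix.mul_add, Matrix.add_mul]
    module
  · have h1 : ∀ k, frob (((t ^ (β + 1 / 2) : ℝ) : ℂ) • y0 k) = t ^ (2 * β + 1) * frob (y0 k) := by
      intro k
      rw [frob_smul, Complex.norm_real, Real.norm_of_nonneg (Real.rpow_nonneg ht0.le _),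
        ← Real.rpow_natCast, ← Real.rpow_mul ht0.le]
      congr 2
      push_cast
      ring
    rw [Finset.sum_congr rfl fun k _ => h1 k, ← Finset.mul_sum]
    have h2 : t ^ (2 * β + 1) ≤ 3 ^ (2 * β + 1) :=
      Real.rpow_le_rpow ht0.le ht3 (by linarith)
    calc t ^ (2 * β + 1) * ∑ k, frob (y0 k) ≤ 3 ^ (2 * β + 1) * (8 * τ ^ 2) := by
          refine mul_le_mul h2 hy0s (Finset.sum_nonneg fun k _ => frob_nonneg _) (by positivity)
      _ = _ := by ring

end JordanProduct

section Contractions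

variable {ι : Type*} [Fintype ι]

theorem sum_norm_sq_col (A : Matrix ι ι ℂ) (i : ι) :
    ∑ j, ‖A j i‖ ^ 2 = ((Aᴴ * A) i i).re := by
  simp only [mul_apply, conjTranspose_apply, Complex.re_sum]
  refine Finset.sum_congr rfl fun j _ => ?_
  rw [Complex.star_def, ← Complex.normSq_eq_conj_mul_self, Complex.ofReal_re,
    Complex.normSq_eq_norm_sq]

variable [DecidableEq ι]

theorem contraction_mul {A B : Matrix ι ι ℂ} (hA : (1 - Aᴴ * A).PosSemidef)
    (hB : (1 - Bᴴ * B).PosSemidef) : (1 - (A * B)ᴴ * (A * B)).PosSemidef := by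
  have h := hB.add (hA.conjTranspose_mul_mul_same B)
  convert h using 1
  rw [conjTranspose_mul]
  noncomm_ring

theorem contraction_diagonal {e : ι → ℝ} (h0 : ∀ i, 0 ≤ e i) (h1 : ∀ i, e i ≤ 1) :
    (1 - (diagonal fun i => (e i : ℂ))ᴴ * diagonal fun i => (e i : ℂ)).PosSemidef := by
  rw [diagonal_conjTranspose, diagonal_mul_diagonal, ← diagonal_one, diagonal_sub,
    posSemidef_diagonal_iff]
  intro i
  have : (0 : ℝ) ≤ 1 - e i * e i := by nlinarith [h0 i, h1 i]
  simp only [Pi.star_apply, Complex.star_def, Complex.conj_ofReal]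
  exact_mod_cast this

theorem norm_trace_le_sum_sqrt {V W : Matrix ι ι ℂ} (hV : (1 - Vᴴ * V).PosSemidef)
    (hW : Wᴴ * W = 1) (hW' : W * Wᴴ = 1) (A : Matrix ι ι ℂ) :
    ‖(Vᴴ * A).trace‖ ≤ ∑ i, √(∑ j, ‖(A * W) j i‖ ^ 2) := by
  have e : (Vᴴ * A).trace = ((V * W)ᴴ * (A * W)).trace := by
    rw [conjTranspose_mul, Matrix.mul_assoc, trace_mul_comm Wᴴ, Matrix.mul_assoc, Matrix.mul_assoc,
      hW', Matrix.mul_one]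
  have hW1 : (1 - Wᴴ * W).PosSemidef := by rw [hW, sub_self]; exact PosSemidef.zero
  have hc := contraction_mul hV hW1
  rw [e, trace]
  refine (norm_sum_le _ _).trans (Finset.sum_le_sum fun i _ => ?_)
  have hi : ∑ j, ‖(V * W) j i‖ ^ 2 ≤ 1 := by
    rw [sum_norm_sq_col]
    have := (Complex.le_def.1 (hc.diag_nonneg (i := i))).1
    simp only [Matrix.sub_apply, one_apply_eq, Complex.sub_re, Complex.one_re,
      Complex.zero_re] at this
    linarith
  rw [diag_apply, mul_apply]
  calc ‖∑ j, (V * W)ᴴ i j * (A * W) j i‖ ≤ ∑ j, ‖(V * W) j i‖ * ‖(A * W) j i‖ := by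
        refine (norm_sum_le _ _).trans (Finset.sum_le_sum fun j _ => ?_)
        rw [norm_mul, conjTranspose_apply, norm_star]
    _ ≤ √(∑ j, ‖(V * W) j i‖ ^ 2) * √(∑ j, ‖(A * W) j i‖ ^ 2) :=
        Real.sum_mul_le_sqrt_mul_sqrt _ _ _
    _ ≤ 1 * √(∑ j, ‖(A * W) j i‖ ^ 2) := by
        gcongr
        exact Real.sqrt_le_one.2 hi
    _ = _ := one_mul _

theorem sum_norm_sq_mul_eigenvectorUnitary (A : Matrix ι ι ℂ) (i : ι) :
    ∑ j, ‖(A * ((isHermitian_conjTranspose_mul_self A).eigenvectorUnitary : Matrix ι ι ℂ)) j i‖ ^ 2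
      = (isHermitian_conjTranspose_mul_self A).eigenvalues i := by
  set hA := isHermitian_conjTranspose_mul_self A
  have h := posPow_eq_unitary hA 1
  rw [posPow_one (posSemidef_conjTranspose_mul_self A)] at h
  set U := (hA.eigenvectorUnitary : Matrix ι ι ℂ)
  have hU : Uᴴ * U = 1 := eigenvectorUnitary_conjTranspose_mul hA
  rw [sum_norm_sq_col, conjTranspose_mul]
  have : Uᴴ * Aᴴ * (A * U) = diagonal (fun i => ((hA.eigenvalues i ^ (1 : ℝ) : ℝ) : ℂ)) := by
    calc Uᴴ * Aᴴ * (A * U) = Uᴴ * (Aᴴ * A) * U := by simp only [Matrix.mul_assoc]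
      _ = Uᴴ * (U * diagonal (fun i => ((hA.eigenvalues i ^ (1 : ℝ) : ℝ) : ℂ)) * Uᴴ) * U :=
        congrArg (Uᴴ * · * U) h
      _ = (Uᴴ * U) * diagonal (fun i => ((hA.eigenvalues i ^ (1 : ℝ) : ℝ) : ℂ)) * (Uᴴ * U) := by
        simp only [Matrix.mul_assoc]
      _ = _ := by rw [hU, Matrix.one_mul, Matrix.mul_one]
  rw [this, diagonal_apply_eq, Complex.ofReal_re, Real.rpow_one]

theorem norm_trace_le_sqrt_rank {V : Matrix ι ι ℂ} (hV : (1 - Vᴴ * V).PosSemidef)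
    (A : Matrix ι ι ℂ) : ‖(Vᴴ * A).trace‖ ≤ √A.rank * √(frob A) := by
  classical
  set hA := isHermitian_conjTranspose_mul_self A with hAdef
  set U := (hA.eigenvectorUnitary : Matrix ι ι ℂ) with hUdef
  have hU' : U * Uᴴ = 1 := eigenvectorUnitary_mul_conjTranspose hA
  have h := norm_trace_le_sum_sqrt hV (eigenvectorUnitary_conjTranspose_mul hA) hU' A
  have hs : ∀ i, √(∑ j, ‖(A * U) j i‖ ^ 2) =
      (if hA.eigenvalues i ≠ 0 then 1 else 0) * √(∑ j, ‖(A * U) j i‖ ^ 2) := by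
    intro i
    split_ifs with hi
    · rw [one_mul]
    · rw [sum_norm_sq_mul_eigenvectorUnitary A i, not_not.1 hi, Real.sqrt_zero, mul_zero]
  rw [Finset.sum_congr rfl fun i _ => hs i] at h
  refine h.trans ((Real.sum_mul_le_sqrt_mul_sqrt _ _ _).trans (le_of_eq ?_))
  congr 2
  · rw [← rank_conjTranspose_mul_self A, hA.rank_eq_card_non_zero_eigs, Fintype.card_subtype]
    simp [Finset.sum_ite]
  · rw [← frob_mul_unitary hU' A, frob_eq_sum, Finset.sum_comm]
    exact Finset.sum_congr rfl fun i _ => Real.sq_sqrt (Finset.sum_nonneg fun j _ => sq_nonneg _)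

theorem norm_trace_diagonal_le {V Y W : Matrix ι ι ℂ} {σ e : ι → ℝ}
    (hV : (1 - Vᴴ * V).PosSemidef) (hW : Wᴴ * W = 1) (hW' : W * Wᴴ = 1)
    (hσ : ∀ i, 0 ≤ σ i) (hYW : ∀ i, ∑ j, ‖(Y * W) j i‖ ^ 2 = σ i ^ 2)
    (h0 : ∀ i, 0 ≤ e i) (h1 : ∀ i, e i ≤ 1) (I : Finset ι) {w : ℝ} (hw : 0 < w) :
    ‖(Vᴴ * (diagonal (fun i => (e i : ℂ)) * Y * diagonal (fun i => (e i : ℂ)))).trace‖ ≤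
      ∑ i, (if i ∈ I then w / 2 else σ i + w⁻¹ * σ i ^ 2) +
        w⁻¹ * frob (diagonal (fun i => (e i : ℂ)) * Y * diagonal (fun i => (e i : ℂ))) := by
  set E : Matrix ι ι ℂ := diagonal (fun i => (e i : ℂ)) with hE
  have hEc : (1 - Eᴴ * E).PosSemidef := contraction_diagonal h0 h1
  have hEh : Eᴴ = E := by
    rw [hE, diagonal_conjTranspose]
    congr 1
    ext i
    simp
  set D : Matrix ι ι ℂ := diagonal (fun i => if i ∈ I then 1 else 0) with hD
  set R : Matrix ι ι ℂ := diagonal (fun i => if i ∈ I then 0 else 1) with hR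
  have hDR : D + R = 1 := by
    rw [hD, hR, diagonal_add, ← diagonal_one]
    congr 1
    ext i
    by_cases hi : i ∈ I <;> simp [hi]
  have hsplit : Y = Y * W * D * Wᴴ + Y * W * R * Wᴴ := by
    rw [← Matrix.add_mul, ← Matrix.mul_add, hDR, Matrix.mul_one, Matrix.mul_assoc, hW',
      Matrix.mul_one]
  set Y1 := Y * W * D * Wᴴ with hY1
  set Y2 := Y * W * R * Wᴴ with hY2
  have hY2W : Y2 * W = Y * W * R := by
    rw [hY2, Matrix.mul_assoc, hW, Matrix.mul_one]
  have hcol : ∀ i, ∑ j, ‖(Y2 * W) j i‖ ^ 2 = if i ∈ I then 0 else σ i ^ 2 := by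
    intro i
    simp only [hY2W, hR, mul_diagonal]
    by_cases hi : i ∈ I
    · simp [hi]
    · simp [hi, hYW]
  have hfY2 : frob Y2 = ∑ i, if i ∈ I then 0 else σ i ^ 2 := by
    rw [← frob_mul_unitary hW' Y2, frob_eq_sum, Finset.sum_comm]
    exact Finset.sum_congr rfl fun i _ => hcol i
  have hEY2 : frob (E * Y2 * E) ≤ frob Y2 := by
    refine frob_le_frob fun i j => ?_
    rw [hE, mul_diagonal, diagonal_mul, norm_mul, norm_mul, Complex.norm_real, Complex.norm_real,
      Real.norm_of_nonneg (h0 i), Real.norm_of_nonneg (h0 j)]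
    have := norm_nonneg (Y2 i j)
    nlinarith [mul_le_mul (h1 i) (h1 j) (h0 j) zero_le_one]
  have t2 : ‖(Vᴴ * (E * Y2 * E)).trace‖ ≤ ∑ i, if i ∈ I then 0 else σ i := by
    have e1 : (Vᴴ * (E * Y2 * E)).trace = ((E * (V * E))ᴴ * Y2).trace := by
      rw [conjTranspose_mul, conjTranspose_mul, hEh, ← Matrix.mul_assoc, trace_mul_comm]
      simp only [Matrix.mul_assoc]
    rw [e1]
    refine (norm_trace_le_sum_sqrt (contraction_mul hEc (contraction_mul hV hEc)) hW hW' Y2).trans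
      (le_of_eq (Finset.sum_congr rfl fun i _ => ?_))
    rw [hcol]
    split_ifs
    · exact Real.sqrt_zero
    · exact Real.sqrt_sq (hσ i)
  have hrank : (E * Y1 * E).rank ≤ I.card := by
    have e2 : E * Y1 * E = E * Y * W * D * (Wᴴ * E) := by
      rw [hY1]; simp only [Matrix.mul_assoc]
    rw [e2]
    refine (rank_mul_le_left _ _).trans ((rank_mul_le_right _ _).trans ?_)
    rw [hD, rank_diagonal, Fintype.card_subtype]
    simp
  have hf1 : frob (E * Y1 * E) ≤ 2 * (frob (E * Y * E) + frob Y2) := by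
    have e3 : E * Y1 * E = E * Y * E + -(E * Y2 * E) := by
      conv_rhs => rw [hsplit]
      noncomm_ring
    rw [e3]
    refine (frob_add_le _ _).trans ?_
    have : frob (-(E * Y2 * E)) = frob (E * Y2 * E) := by simp [frob]
    rw [this]
    linarith
  have t1 : ‖(Vᴴ * (E * Y1 * E)).trace‖ ≤
      w / 2 * I.card + w⁻¹ * (frob (E * Y * E) + frob Y2) := by
    refine (norm_trace_le_sqrt_rank hV _).trans ?_
    have a1 : √((E * Y1 * E).rank : ℝ) ≤ √(I.card : ℝ) :=
      Real.sqrt_le_sqrt (by exact_mod_cast hrank)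
    set a := √(I.card : ℝ) with ha
    have ha2 : a ^ 2 = I.card := Real.sq_sqrt (Nat.cast_nonneg _)
    set b := √(frob (E * Y1 * E)) with hb
    have hb2 : b ^ 2 = frob (E * Y1 * E) := Real.sq_sqrt (frob_nonneg _)
    have hb0 : 0 ≤ b := Real.sqrt_nonneg _
    rw [← ha2]
    have key : a * b ≤ w / 2 * a ^ 2 + w⁻¹ * (b ^ 2 / 2) := by
      have : w / 2 * a ^ 2 + w⁻¹ * (b ^ 2 / 2) - a * b = w⁻¹ * ((w * a - b) ^ 2 / 2) := by
        field_simp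
        ring
      have := mul_nonneg (inv_pos.2 hw).le (div_nonneg (sq_nonneg (w * a - b)) zero_le_two)
      linarith
    have : w⁻¹ * (b ^ 2 / 2) ≤ w⁻¹ * (frob (E * Y * E) + frob Y2) := by
      gcongr
      linarith
    nlinarith
  have hsum : E * Y * E = E * Y1 * E + E * Y2 * E := by
    conv_lhs => rw [hsplit]
    noncomm_ring
  have hfin : ∑ i, (if i ∈ I then w / 2 else σ i + w⁻¹ * σ i ^ 2) =
      w / 2 * I.card + (∑ i, if i ∈ I then 0 else σ i) +
        w⁻¹ * ∑ i, if i ∈ I then 0 else σ i ^ 2 := by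
    have : w / 2 * (I.card : ℝ) = ∑ i, if i ∈ I then w / 2 else 0 := by
      simp [Finset.sum_ite_mem, mul_comm]
    rw [this, Finset.mul_sum, ← Finset.sum_add_distrib, ← Finset.sum_add_distrib]
    refine Finset.sum_congr rfl fun i _ => ?_
    split_ifs <;> ring
  have htr : ‖(Vᴴ * (E * Y * E)).trace‖ ≤
      ‖(Vᴴ * (E * Y1 * E)).trace‖ + ‖(Vᴴ * (E * Y2 * E)).trace‖ := by
    rw [hsum, Matrix.mul_add, trace_add]
    exact norm_add_le _ _
  rw [hfin, ← hfY2]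
  linarith

end Contractions

section LaplaceInterpolation

open Set

theorem integral_Ioi_ite_rpow {τ μ s σ : ℝ} (hτ : 0 < τ) (hs : 0 < s) :
    IntegrableOn (fun t : ℝ => if τ < t then μ * t ^ (-(1 + s)) / 2
      else σ + μ⁻¹ * t ^ (1 + s) * σ ^ 2) (Ioi 0) ∧
    ∫ t in Ioi (0 : ℝ), (if τ < t then μ * t ^ (-(1 + s)) / 2
      else σ + μ⁻¹ * t ^ (1 + s) * σ ^ 2) =
      τ * σ + μ⁻¹ * (τ ^ (2 + s) / (2 + s)) * σ ^ 2 + μ / 2 * (τ ^ (-s) / s) := by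
  set g : ℝ → ℝ := fun t => if τ < t then μ * t ^ (-(1 + s)) / 2
      else σ + μ⁻¹ * t ^ (1 + s) * σ ^ 2
  have e1 : EqOn g (fun t => σ + μ⁻¹ * t ^ (1 + s) * σ ^ 2) (Ioc 0 τ) := fun t ht => by
    simp only [g, if_neg (not_lt.2 ht.2)]
  have e2 : EqOn g (fun t => μ / 2 * t ^ (-(1 + s))) (Ioi τ) := fun t ht => by
    simp only [g, if_pos (mem_Ioi.1 ht)]
    ring
  have hlt : -(1 + s) < -1 := by linarith
  have hii : IntervalIntegrable (fun t : ℝ => t ^ (1 + s)) volume 0 τ :=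
    intervalIntegral.intervalIntegrable_rpow' (by linarith)
  have hi1' : IntervalIntegrable (fun t : ℝ => σ + μ⁻¹ * t ^ (1 + s) * σ ^ 2) volume 0 τ :=
    intervalIntegrable_const.add ((hii.const_mul _).mul_const _)
  have i1 : IntegrableOn g (Ioc 0 τ) := by
    rw [integrableOn_congr_fun e1 measurableSet_Ioc]
    exact (intervalIntegrable_iff_integrableOn_Ioc_of_le hτ.le).1 hi1'
  have i2 : IntegrableOn g (Ioi τ) := by
    rw [integrableOn_congr_fun e2 measurableSet_Ioi]
    exact (integrableOn_Ioi_rpow_of_lt hlt hτ).const_mul _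
  rw [← Ioc_union_Ioi_eq_Ioi hτ.le]
  refine ⟨i1.union i2, ?_⟩
  change ∫ t in Ioc 0 τ ∪ Ioi τ, g t = _
  rw [setIntegral_union (Ioc_disjoint_Ioi le_rfl) measurableSet_Ioi i1 i2,
    setIntegral_congr_fun measurableSet_Ioc e1, setIntegral_congr_fun measurableSet_Ioi e2,
    integral_const_mul, integral_Ioi_rpow_of_lt hlt hτ,
    ← intervalIntegral.integral_of_le hτ.le,
    intervalIntegral.integral_add intervalIntegrable_const ((hii.const_mul _).mul_const _),
    intervalIntegral.integral_mul_const, intervalIntegral.integral_const_mul,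
    integral_rpow (Or.inl (by linarith)), intervalIntegral.integral_const,
    Real.zero_rpow (by linarith)]
  have h1 : 1 + s + 1 = 2 + s := by ring
  have h2 : -(1 + s) + 1 = -s := by ring
  rw [h1, h2, smul_eq_mul, sub_zero, sub_zero, neg_div_neg_eq]

theorem integral_Ioi_singular_value {p s K μ σ : ℝ} (hp : 0 < p) (hs : 0 < s)
    (hps : s * (1 - p) = p) (hK : 0 < K) (hσ : 0 ≤ σ) :
    IntegrableOn (fun t : ℝ => if 0 < σ ∧ K * σ ^ (p - 1) < t then μ * t ^ (-(1 + s)) / 2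
      else σ + μ⁻¹ * t ^ (1 + s) * σ ^ 2) (Ioi 0) ∧
    ∫ t in Ioi (0 : ℝ), (if 0 < σ ∧ K * σ ^ (p - 1) < t then μ * t ^ (-(1 + s)) / 2
      else σ + μ⁻¹ * t ^ (1 + s) * σ ^ 2) =
      (K + μ⁻¹ * (K ^ (2 + s) / (2 + s)) + μ / 2 * (K ^ (-s) / s)) * σ ^ p := by
  rcases hσ.eq_or_lt with h | h
  · subst h
    simp [Real.zero_rpow hp.ne']
  · have hτ : 0 < K * σ ^ (p - 1) := by positivity
    have hm := integral_Ioi_ite_rpow (μ := μ) (σ := σ) hτ hs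
    simp only [h, true_and]
    refine ⟨hm.1, hm.2.trans ?_⟩
    have hσ0 := h.le
    have a1 : σ ^ (p - 1) * σ = σ ^ p := by
      rw [← Real.rpow_add_one h.ne']; congr 1; ring
    have a2 : (σ ^ (p - 1)) ^ (2 + s) * σ ^ 2 = σ ^ p := by
      rw [← Real.rpow_mul hσ0, ← Real.rpow_natCast σ 2, ← Real.rpow_add h]
      congr 1
      push_cast
      linear_combination -hps
    have a3 : (σ ^ (p - 1)) ^ (-s) = σ ^ p := by
      rw [← Real.rpow_mul hσ0]
      congr 1
      linear_combination hps
    rw [Real.mul_rpow hK.le (by positivity), Real.mul_rpow hK.le (by positivity), a3]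
    linear_combination K * a1 + μ⁻¹ * (K ^ (2 + s) / (2 + s)) * a2

theorem integral_Ioi_rpow_mul_exp {a r : ℝ} (ha : 0 < a) (hr : 0 < r) :
    IntegrableOn (fun t : ℝ => t ^ (a - 1) * Real.exp (-(r * t))) (Ioi 0) ∧
    ∫ t in Ioi (0 : ℝ), t ^ (a - 1) * Real.exp (-(r * t)) = Real.Gamma a * r ^ (-a) := by
  have h := Real.integral_rpow_mul_exp_neg_mul_Ioi ha hr
  refine ⟨Integrable.of_integral_ne_zero ?_, ?_⟩
  · rw [h]
    have := Real.Gamma_pos_of_pos ha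
    positivity
  · rw [h, one_div, Real.inv_rpow hr.le, Real.rpow_neg hr.le, mul_comm]

variable {ι : Type*} [Fintype ι] [DecidableEq ι]

theorem norm_sum_div_add_le {V Y W : Matrix ι ι ℂ} {σ x : ι → ℝ} {p s K μ : ℝ}
    (hp : 0 < p) (hs : 0 < s) (hps : s * (1 - p) = p) (hK : 0 < K) (hμ : 0 < μ)
    (hV : (1 - Vᴴ * V).PosSemidef) (hW : Wᴴ * W = 1) (hW' : W * Wᴴ = 1)
    (hσ : ∀ i, 0 ≤ σ i) (hYW : ∀ i, ∑ j, ‖(Y * W) j i‖ ^ 2 = σ i ^ 2) (hx : ∀ i, 0 < x i) :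
    ‖∑ i, ∑ j, star (V i j) * Y i j * (((x i + x j)⁻¹ : ℝ) : ℂ)‖ ≤
      (K + μ⁻¹ * (K ^ (2 + s) / (2 + s)) + μ / 2 * (K ^ (-s) / s)) * ∑ i, σ i ^ p +
        μ⁻¹ * Real.Gamma (2 + s) * ∑ i, ∑ j, ‖Y i j‖ ^ 2 * (2 * (x i + x j)) ^ (-(2 + s)) := by
  have hxx : ∀ i j, 0 < x i + x j := fun i j => add_pos (hx i) (hx j)
  set E : ℝ → Matrix ι ι ℂ := fun t => diagonal fun i => ((Real.exp (-(x i * t)) : ℝ) : ℂ) with hE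
  have hEYE : ∀ t i j, (E t * Y * E t) i j = Y i j * ((Real.exp (-((x i + x j) * t)) : ℝ) : ℂ) := by
    intro t i j
    have : Real.exp (-((x i + x j) * t)) = Real.exp (-(x i * t)) * Real.exp (-(x j * t)) := by
      rw [← Real.exp_add]; congr 1; ring
    rw [hE, mul_diagonal, diagonal_mul, this, Complex.ofReal_mul]
    ring
  have htr : ∀ t, (Vᴴ * (E t * Y * E t)).trace =
      ∑ i, ∑ j, star (V i j) * Y i j * ((Real.exp (-((x i + x j) * t)) : ℝ) : ℂ) := by
    intro t
    rw [trace, Finset.sum_comm]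
    simp only [diag_apply, mul_apply (M := Vᴴ), conjTranspose_apply, hEYE]
    exact Finset.sum_congr rfl fun i _ => Finset.sum_congr rfl fun j _ => (mul_assoc _ _ _).symm
  have hfr : ∀ t, frob (E t * Y * E t) =
      ∑ i, ∑ j, ‖Y i j‖ ^ 2 * Real.exp (-(2 * (x i + x j) * t)) := by
    intro t
    rw [frob_eq_sum]
    refine Finset.sum_congr rfl fun i _ => Finset.sum_congr rfl fun j _ => ?_
    rw [hEYE, norm_mul, Complex.norm_real, Real.norm_of_nonneg (Real.exp_pos _).le, mul_pow,
      ← Real.exp_nat_mul]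
    congr 2
    push_cast
    ring
  have hexp : ∀ i j, IntegrableOn (fun t : ℝ => Real.exp (-((x i + x j) * t))) (Ioi 0) ∧
      ∫ t in Ioi (0 : ℝ), Real.exp (-((x i + x j) * t)) = (x i + x j)⁻¹ := by
    intro i j
    have := integral_Ioi_rpow_mul_exp one_pos (hxx i j)
    simpa [Real.rpow_neg_one] using this
  have hL : ∑ i, ∑ j, star (V i j) * Y i j * (((x i + x j)⁻¹ : ℝ) : ℂ) =
      ∫ t in Ioi (0 : ℝ), (Vᴴ * (E t * Y * E t)).trace := by
    simp only [htr]
    have hint : ∀ i j, IntegrableOn (fun t : ℝ => star (V i j) * Y i j *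
        ((Real.exp (-((x i + x j) * t)) : ℝ) : ℂ)) (Ioi 0) := fun i j =>
      (Integrable.ofReal (hexp i j).1).const_mul _
    rw [integral_finsetSum _ fun i _ => integrable_finsetSum _ fun j _ => hint i j]
    refine Finset.sum_congr rfl fun i _ => ?_
    rw [integral_finsetSum _ fun j _ => hint i j]
    refine Finset.sum_congr rfl fun j _ => ?_
    rw [integral_const_mul, integral_complex_ofReal, (hexp i j).2]
  have h2 : ∀ i j, IntegrableOn (fun t : ℝ => ‖Y i j‖ ^ 2 *
      (t ^ (2 + s - 1) * Real.exp (-(2 * (x i + x j) * t)))) (Ioi 0) := fun i j =>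
    (integral_Ioi_rpow_mul_exp (by linarith) (mul_pos two_pos (hxx i j))).1.const_mul _
  have h2s : IntegrableOn (fun t : ℝ => μ⁻¹ * ∑ i, ∑ j, ‖Y i j‖ ^ 2 *
      (t ^ (2 + s - 1) * Real.exp (-(2 * (x i + x j) * t)))) (Ioi 0) :=
    (integrable_finsetSum _ fun i _ => integrable_finsetSum _ fun j _ => h2 i j).const_mul _
  have h1 := fun i => integral_Ioi_singular_value (μ := μ) hp hs hps hK (hσ i)
  have h1s := integrable_finsetSum Finset.univ fun i _ => (h1 i).1
  rw [hL]
  refine (norm_integral_le_of_norm_le (h1s.add h2s) ?_).trans (le_of_eq ?_)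
  · refine (ae_restrict_iff' measurableSet_Ioi).2 (Filter.Eventually.of_forall fun t ht => ?_)
    have ht0 : (0 : ℝ) < t := ht
    have hw : 0 < μ * t ^ (-(1 + s)) := by positivity
    have := norm_trace_diagonal_le (e := fun i => Real.exp (-(x i * t))) hV hW hW' hσ hYW
      (fun i => (Real.exp_pos _).le)
      (fun i => Real.exp_le_one_iff.2 (neg_nonpos.2 (mul_pos (hx i) ht0).le))
      (Finset.univ.filter fun i => 0 < σ i ∧ K * σ i ^ (p - 1) < t) hw
    refine this.trans (le_of_eq ?_)
    have hinv : (μ * t ^ (-(1 + s)))⁻¹ = μ⁻¹ * t ^ (1 + s) := by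
      rw [mul_inv, Real.rpow_neg ht0.le, inv_inv]
    have hf := hfr t
    simp only [hE] at hf
    rw [hf, hinv]
    simp only [Finset.mem_filter, Finset.mem_univ, true_and, Pi.add_apply]
    congr 1
    have : 2 + s - 1 = 1 + s := by ring
    rw [this]
    simp only [Finset.mul_sum]
    refine Finset.sum_congr rfl fun i _ => Finset.sum_congr rfl fun j _ => ?_
    ring
  · rw [integral_add' h1s h2s, integral_finsetSum _ fun i _ => (h1 i).1, integral_const_mul,
      integral_finsetSum _ fun i _ => integrable_finsetSum _ fun j _ => h2 i j]
    simp only [fun i => (h1 i).2, ← Finset.mul_sum]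
    rw [mul_assoc μ⁻¹]
    congr 2
    rw [Finset.mul_sum]
    refine Finset.sum_congr rfl fun i _ => ?_
    rw [integral_finsetSum _ fun j _ => h2 i j, Finset.mul_sum]
    refine Finset.sum_congr rfl fun j _ => ?_
    rw [integral_const_mul,
      (integral_Ioi_rpow_mul_exp (by linarith) (mul_pos two_pos (hxx i j))).2]
    ring

end LaplaceInterpolation

section JordanInterpolation

variable {ι : Type*} [Fintype ι] [DecidableEq ι]

theorem exists_jordan_solution {f : Matrix ι ι ℂ} (hf : f.PosDef) {β : ℝ} (hβ : 0 ≤ β)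
    (Y : Matrix ι ι ℂ) :
    ∃ Z : Matrix ι ι ℂ, Y = (1 / 2 : ℂ) • (posPow f β * Z + Z * posPow f β) := by
  obtain ⟨Z, hZ, -⟩ := exists_jordan_inverse hf hβ le_rfl (posPow f (-β) * Y)
  refine ⟨Z, ?_⟩
  rwa [posPow_zero hf, Matrix.mul_one, ← Matrix.mul_assoc, posPow_mul_neg_self hf,
    Matrix.one_mul, add_zero] at hZ

theorem reTr_posPow_eq_sum_eigenvalues {A : Matrix ι ι ℂ} (hA : A.IsHermitian) (r : ℝ) :
    reTr (posPow A r) = ∑ i, hA.eigenvalues i ^ r := by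
  rw [posPow_eq_unitary hA, reTr, trace_mul_comm, ← Matrix.mul_assoc,
    eigenvectorUnitary_conjTranspose_mul hA, Matrix.one_mul, trace_diagonal, Complex.re_sum]
  simp only [Complex.ofReal_re]

theorem rpow_add_rpow_sq_mul_le {a b β s : ℝ} (ha : 0 < a) (hb : 0 < b) (hs : 0 < s)
    (hβs : β * s = 1) :
    ((a ^ (β + 1 / 2) + b ^ (β + 1 / 2)) / 2) ^ 2 * (2 * (a ^ β + b ^ β)) ^ (-(2 + s)) ≤ 1 := by
  have hpos : 0 < 2 * (a ^ β + b ^ β) := by positivity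
  have key : ∀ c : ℝ, 0 < c → c ^ β ≤ 2 * (a ^ β + b ^ β) →
      (c ^ (β + 1 / 2)) ^ 2 ≤ (2 * (a ^ β + b ^ β)) ^ (2 + s) := by
    intro c hc h
    have e : (c ^ (β + 1 / 2)) ^ 2 = (c ^ β) ^ (2 + s) := by
      rw [← Real.rpow_natCast, ← Real.rpow_mul hc.le, ← Real.rpow_mul hc.le]
      congr 1
      push_cast
      linear_combination -hβs
    rw [e]
    exact Real.rpow_le_rpow (by positivity) h (by linarith)
  have ha' := key a ha (by nlinarith [Real.rpow_pos_of_pos ha β, Real.rpow_pos_of_pos hb β])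
  have hb' := key b hb (by nlinarith [Real.rpow_pos_of_pos ha β, Real.rpow_pos_of_pos hb β])
  rw [Real.rpow_neg hpos.le, ← div_eq_mul_inv, div_le_one (by positivity)]
  nlinarith [sq_nonneg (a ^ (β + 1 / 2) - b ^ (β + 1 / 2))]

theorem reTr_conjTranspose_mul_jordan_le {f V y Y Z : Matrix ι ι ℂ} {p s β K μ : ℝ}
    (hp : 0 < p) (hs : 0 < s) (hps : s * (1 - p) = p) (hβs : β * s = 1) (hK : 0 < K) (hμ : 0 < μ)
    (hf : f.PosDef) (hV : (1 - Vᴴ * V).PosSemidef)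
    (hy : Y = (1 / 2 : ℂ) • (posPow f (β + 1 / 2) * y + y * posPow f (β + 1 / 2)))
    (hZ : Y = (1 / 2 : ℂ) • (posPow f β * Z + Z * posPow f β)) :
    reTr (Vᴴ * Z) ≤
      2 * ((K + μ⁻¹ * (K ^ (2 + s) / (2 + s)) + μ / 2 * (K ^ (-s) / s)) *
        reTr (posPow (Yᴴ * Y) (p / 2)) + μ⁻¹ * Real.Gamma (2 + s) * frob y) := by
  set U := (hf.1.eigenvectorUnitary : Matrix ι ι ℂ) with hUdef
  have hU : Uᴴ * U = 1 := eigenvectorUnitary_conjTranspose_mul hf.1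
  have hU' : U * Uᴴ = 1 := eigenvectorUnitary_mul_conjTranspose hf.1
  set η := hf.1.eigenvalues
  have hη : ∀ i, 0 < η i := fun i => hf.eigenvalues_pos i
  have hpow : ∀ r, posPow f r = U * diagonal (fun i => ((η i ^ r : ℝ) : ℂ)) * Uᴴ :=
    posPow_eq_unitary hf.1
  have hrel : ∀ (r : ℝ) (X : Matrix ι ι ℂ), Y = (1 / 2 : ℂ) • (posPow f r * X + X * posPow f r) →
      ∀ i j, (Uᴴ * Y * U) i j = ((((η i ^ r + η j ^ r) / 2 : ℝ)) : ℂ) * (Uᴴ * X * U) i j := by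
    intro r X hX i j
    have : Uᴴ * Y * U = (1 / 2 : ℂ) • (diagonal (fun i => ((η i ^ r : ℝ) : ℂ)) * (Uᴴ * X * U) +
        Uᴴ * X * U * diagonal (fun i => ((η i ^ r : ℝ) : ℂ))) := by
      rw [hX, hpow, Matrix.mul_smul, Matrix.smul_mul, Matrix.mul_add, Matrix.add_mul]
      congr 2
      · simp only [← Matrix.mul_assoc]
        rw [hU, Matrix.one_mul]
      · simp only [Matrix.mul_assoc]
        rw [hU, Matrix.mul_one]
    rw [this, Matrix.smul_apply, Matrix.add_apply, diagonal_mul, mul_diagonal, smul_eq_mul]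
    push_cast
    ring
  set hH := isHermitian_conjTranspose_mul_self Y with hHdef
  set W₀ := (hH.eigenvectorUnitary : Matrix ι ι ℂ) with hW₀
  have hW1 : W₀ᴴ * W₀ = 1 := eigenvectorUnitary_conjTranspose_mul hH
  have hW2 : W₀ * W₀ᴴ = 1 := eigenvectorUnitary_mul_conjTranspose hH
  have hW : (Uᴴ * W₀)ᴴ * (Uᴴ * W₀) = 1 := by
    rw [conjTranspose_mul, conjTranspose_conjTranspose, Matrix.mul_assoc, ← Matrix.mul_assoc U,
      hU', Matrix.one_mul, hW1]
  have hW' : (Uᴴ * W₀) * (Uᴴ * W₀)ᴴ = 1 := by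
    rw [conjTranspose_mul, conjTranspose_conjTranspose, Matrix.mul_assoc, ← Matrix.mul_assoc W₀,
      hW2, Matrix.one_mul, hU]
  have hev : ∀ i, 0 ≤ hH.eigenvalues i := (posSemidef_conjTranspose_mul_self Y).eigenvalues_nonneg
  have hYW : ∀ i, ∑ j, ‖(Uᴴ * Y * U * (Uᴴ * W₀)) j i‖ ^ 2 = √(hH.eigenvalues i) ^ 2 := by
    intro i
    rw [Real.sq_sqrt (hev i), ← sum_norm_sq_mul_eigenvectorUnitary Y i, sum_norm_sq_col,
      sum_norm_sq_col]
    have e1 : Uᴴ * Y * U * (Uᴴ * W₀) = Uᴴ * (Y * W₀) := by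
      rw [Matrix.mul_assoc, ← Matrix.mul_assoc U, hU', Matrix.one_mul, Matrix.mul_assoc]
    rw [e1, conjTranspose_mul, conjTranspose_conjTranspose, Matrix.mul_assoc,
      ← Matrix.mul_assoc U, hU', Matrix.one_mul]
  have hV' : (1 - (Uᴴ * V * U)ᴴ * (Uᴴ * V * U)).PosSemidef := by
    have h := hV.conjTranspose_mul_mul_same U
    convert h using 1
    rw [Matrix.mul_sub, Matrix.sub_mul, Matrix.mul_one, hU]
    simp only [conjTranspose_mul, conjTranspose_conjTranspose, Matrix.mul_assoc]
    rw [← Matrix.mul_assoc U Uᴴ, hU', Matrix.one_mul]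
  have hmain := norm_sum_div_add_le (x := fun i => η i ^ β) hp hs hps hK hμ hV' hW hW'
    (fun i => Real.sqrt_nonneg (hH.eigenvalues i)) hYW (fun i => Real.rpow_pos_of_pos (hη i) β)
  have hT : ∑ i, √(hH.eigenvalues i) ^ p = reTr (posPow (Yᴴ * Y) (p / 2)) := by
    rw [reTr_posPow_eq_sum_eigenvalues hH]
    refine Finset.sum_congr rfl fun i _ => ?_
    rw [Real.sqrt_eq_rpow, ← Real.rpow_mul (hev i)]
    congr 1
    ring
  have hΦ : ∑ i, ∑ j, ‖(Uᴴ * Y * U) i j‖ ^ 2 * (2 * (η i ^ β + η j ^ β)) ^ (-(2 + s)) ≤ frob y := by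
    rw [← frob_mul_unitary hU' y, ← frob_unitary_mul (U := Uᴴ)
      (by rw [conjTranspose_conjTranspose, hU']) (y * U), ← Matrix.mul_assoc, frob_eq_sum]
    refine Finset.sum_le_sum fun i _ => Finset.sum_le_sum fun j _ => ?_
    rw [hrel _ y hy i j, norm_mul, mul_pow, Complex.norm_real, Real.norm_eq_abs, sq_abs,
      mul_right_comm]
    exact mul_le_of_le_one_left (sq_nonneg _) (rpow_add_rpow_sq_mul_le (hη i) (hη j) hs hβs)
  have htr : (Vᴴ * Z).trace = 2 * ∑ i, ∑ j, star ((Uᴴ * V * U) i j) * (Uᴴ * Y * U) i j *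
      (((η i ^ β + η j ^ β)⁻¹ : ℝ) : ℂ) := by
    have e1 : (Vᴴ * Z).trace = ((Uᴴ * V * U)ᴴ * (Uᴴ * Z * U)).trace := by
      simp only [conjTranspose_mul, conjTranspose_conjTranspose, Matrix.mul_assoc]
      rw [← Matrix.mul_assoc U Uᴴ, hU', Matrix.one_mul, trace_mul_comm Uᴴ]
      simp only [Matrix.mul_assoc]
      rw [hU', Matrix.mul_one]
    rw [e1, trace, Finset.sum_comm]
    simp only [diag_apply, mul_apply (M := (Uᴴ * V * U)ᴴ), conjTranspose_apply, Finset.mul_sum]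
    refine Finset.sum_congr rfl fun i _ => Finset.sum_congr rfl fun j _ => ?_
    have hne : ((η j ^ β + η i ^ β : ℝ) : ℂ) ≠ 0 := by
      have := Real.rpow_pos_of_pos (hη i) β
      have := Real.rpow_pos_of_pos (hη j) β
      exact_mod_cast (by positivity : η j ^ β + η i ^ β ≠ 0)
    rw [hrel β Z hZ j i, Complex.ofReal_inv, Complex.ofReal_div]
    field_simp
    norm_num
  rw [hT] at hmain
  have h1 : reTr (Vᴴ * Z) ≤ ‖(Vᴴ * Z).trace‖ := Complex.re_le_norm _
  rw [htr, norm_mul, Complex.norm_ofNat] at h1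
  have hG := Real.Gamma_pos_of_pos (by linarith : 0 < 2 + s)
  have h2 := mul_le_mul_of_nonneg_left hΦ (by positivity : 0 ≤ μ⁻¹ * Real.Gamma (2 + s))
  linarith

end JordanInterpolation

section Factorization

variable {ι : Type*} [Fintype ι] [DecidableEq ι]

theorem exists_better_density [Nonempty ι] {N : ℕ} {f : Matrix ι ι ℂ}
    {Y y : Fin N → Matrix ι ι ℂ} {p s β : ℝ}
    (hp : 0 < p) (hs : 0 < s) (hps : s * (1 - p) = p) (hβs : β * s = 1) (hf : f.PosDef)
    (hf1 : reTr f = 1)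
    (hy : ∀ k, Y k = (1 / 2 : ℂ) • (posPow f (β + 1 / 2) * y k + y k * posPow f (β + 1 / 2)))
    (hY : signAvg (fun ε => reTr (posPow ((signSum ε Y)ᴴ * signSum ε Y) (p / 2))) ≤ 2) :
    ∃ h : Matrix ι ι ℂ, h.PosDef ∧ reTr h = 1 ∧ ∃ y' : Fin N → Matrix ι ι ℂ,
      (∀ k, Y k = (1 / 2 : ℂ) • (posPow h (β + 1 / 2) * y' k + y' k * posPow h (β + 1 / 2))) ∧
      ∃ τ : ℝ, 0 ≤ τ ∧ ∑ k, frob (y' k) ≤ 8 * 3 ^ (2 * β + 1) * τ ^ 2 ∧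
        ∀ K μ : ℝ, 0 < K → 0 < μ → τ / 4 - 1 ≤
          2 * ((K + μ⁻¹ * (K ^ (2 + s) / (2 + s)) + μ / 2 * (K ^ (-s) / s)) * 2 +
            μ⁻¹ * Real.Gamma (2 + s) * ∑ k, frob (y k)) := by
  have hβ : 0 < β := by
    by_contra h
    nlinarith [mul_nonneg (neg_nonneg.2 (not_lt.1 h)) hs.le]
  choose Z hZ using fun k => exists_jordan_solution hf hβ.le (Y k)
  have hn : (0 : ℝ) < Fintype.card ι := by exact_mod_cast Fintype.card_pos
  obtain ⟨c, S, T, hS, hT, hz, hA, hB, hd⟩ :=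
    exists_dual_decomposition Z (δ := 1 / (2 * Fintype.card ι)) (by positivity)
  have h1 : 2 * (Fintype.card ι : ℝ) * (1 / (2 * Fintype.card ι)) = 1 := by field_simp
  rw [h1] at hd
  obtain ⟨V, hV, hVs⟩ := exists_contraction_signAvg hS.posSemidef hT.posSemidef hz hA hB hd
  obtain ⟨h, hh, hh1, y', hy', hcost⟩ := exists_density_of_decomposition hf hf1 hS hT hβ hA hB
  refine ⟨h, hh, hh1, y', fun k => ?_, reTr S + reTr T,
    add_nonneg (reTr_nonneg hS.posSemidef) (reTr_nonneg hT.posSemidef), hcost,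
    fun K μ hK hμ => hVs.trans ?_⟩
  · rw [← hy' k, ← hz k]
    exact hZ k
  · have hJ : ∀ (F : Matrix ι ι ℂ) (X : Fin N → Matrix ι ι ℂ),
        (∀ k, Y k = (1 / 2 : ℂ) • (F * X k + X k * F)) → ∀ ε,
        signSum ε Y = (1 / 2 : ℂ) • (F * signSum ε X + signSum ε X * F) := by
      intro F X hX ε
      have := map_signSum ((1 / 2 : ℂ) • (LinearMap.mulLeft ℂ F + LinearMap.mulRight ℂ F)) ε X
      simp only [LinearMap.smul_apply, LinearMap.add_apply, LinearMap.mulLeft_apply,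
        LinearMap.mulRight_apply, ← hX] at this
      exact this.symm
    have hpt := fun ε => reTr_conjTranspose_mul_jordan_le hp hs hps hβs hK hμ hf (hV ε)
      (hJ _ _ hy ε) (hJ _ _ hZ ε)
    refine (signAvg_mono hpt).trans ?_
    rw [signAvg_const_mul, signAvg_add, signAvg_const_mul, signAvg_const_mul, signAvg_frob]
    have hK' : 0 ≤ K + μ⁻¹ * (K ^ (2 + s) / (2 + s)) + μ / 2 * (K ^ (-s) / s) := by positivity
    have := mul_le_mul_of_nonneg_left hY hK'
    linarith

theorem exists_bound_of_interpolation {s G C₁ : ℝ} (hs : 0 < s) (hG : 0 < G) (hC₁ : 0 < C₁) :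
    ∃ C : ℝ, 0 < C ∧ ∀ m τ Φ : ℝ, 0 ≤ τ → m ≤ C₁ * τ ^ 2 → Φ ≤ m + 1 →
      (∀ K μ : ℝ, 0 < K → 0 < μ → τ / 4 - 1 ≤
        2 * ((K + μ⁻¹ * (K ^ (2 + s) / (2 + s)) + μ / 2 * (K ^ (-s) / s)) * 2 + μ⁻¹ * G * Φ)) →
      m ≤ C := by
  set D := √C₁ with hD
  have hD0 : 0 < D := Real.sqrt_pos.2 hC₁
  have hD2 : D ^ 2 = C₁ := Real.sq_sqrt hC₁.le
  set L := 64 * D * G with hL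
  have hL0 : 0 < L := by positivity
  set K := (32 * D * L / s) ^ (1 / s) with hK
  have hK0 : 0 < K := by positivity
  have hKs : K ^ (-s) = s / (32 * D * L) := by
    rw [hK, ← Real.rpow_mul (by positivity)]
    have : 1 / s * -s = -1 := by field_simp
    rw [this, Real.rpow_neg_one, inv_div]
  set Q := K ^ (2 + s) / (2 + s) with hQ
  have hQ0 : 0 < Q := by positivity
  set B := 1 + 4 * K + 4 * L⁻¹ * Q with hB
  have hB0 : 0 < B := by positivity
  refine ⟨1 + (8 * D * B) ^ 2, by positivity, fun m τ Φ hτ hm hΦ h => ?_⟩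
  rcases le_or_gt m 1 with h1 | h1
  · nlinarith [sq_nonneg (8 * D * B)]
  set r := √m with hr
  have hr2 : r ^ 2 = m := Real.sq_sqrt (by linarith)
  have hr1 : 1 ≤ r := Real.one_le_sqrt.2 h1.le
  have hr0 : 0 < r := by linarith
  have hrτ : r ≤ D * τ := by
    refine le_of_sq_le_sq ?_ (by positivity)
    rw [mul_pow, hD2, hr2]
    exact hm
  have hmain := h K (L * r) hK0 (by positivity)
  have t1 : (L * r)⁻¹ * Q ≤ L⁻¹ * Q := by
    gcongr
    nlinarith
  have t2 : L * r / 2 * (K ^ (-s) / s) = r / (64 * D) := by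
    rw [hKs]
    field_simp
    norm_num
  have t3 : (L * r)⁻¹ * G * Φ ≤ r / (32 * D) := by
    have : (L * r)⁻¹ * G * (2 * r ^ 2) = r / (32 * D) := by
      rw [hL]
      field_simp
      norm_num
    rw [← this]
    have : Φ ≤ 2 * r ^ 2 := by linarith
    gcongr
  rw [t2] at hmain
  have t4 : r / (4 * D) ≤ τ / 4 := by
    rw [div_le_div_iff₀ (by positivity) (by norm_num)]
    nlinarith
  have t5 : r / (8 * D) ≤ B := by
    have e1 : r / (64 * D) = r / D / 64 := by field_simp
    have e2 : r / (32 * D) = r / D / 32 := by field_simp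
    have e3 : r / (4 * D) = r / D / 4 := by field_simp
    have e4 : r / (8 * D) = r / D / 8 := by field_simp
    rw [hB]
    linarith
  rw [div_le_iff₀ (by positivity)] at t5
  have : r ^ 2 ≤ (8 * D * B) ^ 2 := by
    gcongr
    linarith
  linarith

theorem exists_factorization_of_signAvg_le {p s β : ℝ} (hp : 0 < p) (hs : 0 < s)
    (hps : s * (1 - p) = p) (hβs : β * s = 1) :
    ∃ C : ℝ, 0 < C ∧ ∀ (n N : ℕ), 1 ≤ n → ∀ Y : Fin N → Matrix (Fin n) (Fin n) ℂ,
      signAvg (fun ε => reTr (posPow ((signSum ε Y)ᴴ * signSum ε Y) (p / 2))) ≤ 2 →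
      ∃ f : Matrix (Fin n) (Fin n) ℂ, f.PosDef ∧ reTr f = 1 ∧
        ∃ y : Fin N → Matrix (Fin n) (Fin n) ℂ,
          (∀ k, Y k = (1 / 2 : ℂ) • (posPow f (β + 1 / 2) * y k + y k * posPow f (β + 1 / 2))) ∧
          ∑ k, frob (y k) ≤ C := by
  have hβ : 0 < β := by
    by_contra h
    nlinarith [mul_nonneg (neg_nonneg.2 (not_lt.1 h)) hs.le]
  obtain ⟨C, hC, hbound⟩ := exists_bound_of_interpolation hs
    (Real.Gamma_pos_of_pos (by linarith : 0 < 2 + s))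
    (by positivity : (0 : ℝ) < 8 * 3 ^ (2 * β + 1))
  refine ⟨C + 1, by positivity, fun n N hn Y hY => ?_⟩
  have : Nonempty (Fin n) := ⟨⟨0, hn⟩⟩
  set 𝒮 : Set ℝ := {r | ∃ f : Matrix (Fin n) (Fin n) ℂ, f.PosDef ∧ reTr f = 1 ∧
    ∃ y : Fin N → Matrix (Fin n) (Fin n) ℂ,
      (∀ k, Y k = (1 / 2 : ℂ) • (posPow f (β + 1 / 2) * y k + y k * posPow f (β + 1 / 2))) ∧
      ∑ k, frob (y k) = r} with h𝒮
  have hbdd : BddBelow 𝒮 := by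
    refine ⟨0, ?_⟩
    rintro r ⟨f, -, -, y, -, rfl⟩
    exact Finset.sum_nonneg fun k _ => frob_nonneg _
  have hne : 𝒮.Nonempty := by
    have hn0 : (0 : ℝ) < (n : ℝ)⁻¹ := inv_pos.2 (by exact_mod_cast hn)
    have hfd : (((n : ℝ)⁻¹ : ℝ) : ℂ) • (1 : Matrix (Fin n) (Fin n) ℂ) |>.PosDef :=
      PosDef.one.smul (by exact_mod_cast hn0)
    choose y hy using fun k => exists_jordan_solution hfd (by positivity : 0 ≤ β + 1 / 2) (Y k)
    refine ⟨_, _, hfd, ?_, y, hy, rfl⟩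
    rw [reTr_smul, reTr_one, Fintype.card_fin, inv_mul_cancel₀]
    exact_mod_cast (by omega : n ≠ 0)
  obtain ⟨r, ⟨f, hf, hf1, y, hy, hyr⟩, hr⟩ := exists_lt_of_csInf_lt hne (lt_add_one (sInf 𝒮))
  obtain ⟨h, hh, hh1, y', hy', τ, hτ, hcost, hint⟩ :=
    exists_better_density hp hs hps hβs hf hf1 hy hY
  have hm : sInf 𝒮 ≤ ∑ k, frob (y' k) := csInf_le hbdd ⟨h, hh, hh1, y', hy', rfl⟩
  have hle := hbound (sInf 𝒮) τ (∑ k, frob (y k)) hτ (hm.trans hcost) (by linarith) hint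
  exact ⟨f, hf, hf1, y, hy, by linarith⟩

theorem schattenNorm_two_sq (A : Matrix ι ι ℂ) : schattenNorm 2 A ^ 2 = frob A := by
  have h : posPow (Aᴴ * A) (2 / 2) = Aᴴ * A := by
    rw [div_self two_ne_zero, posPow_one (posSemidef_conjTranspose_mul_self A)]
  rw [schattenNorm, h, ← Real.sqrt_eq_rpow]
  exact Real.sq_sqrt (frob_nonneg A)

theorem reTr_posPow_eq_schattenNorm_rpow {p : ℝ} (hp : 0 < p) (A : Matrix ι ι ℂ) :
    reTr (posPow (Aᴴ * A) (p / 2)) = schattenNorm p A ^ p ∧ 0 ≤ schattenNorm p A := by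
  have h : 0 ≤ reTr (posPow (Aᴴ * A) (p / 2)) := by
    rw [reTr_posPow_eq_sum_eigenvalues (isHermitian_conjTranspose_mul_self A)]
    exact Finset.sum_nonneg fun i _ => Real.rpow_nonneg
      ((posSemidef_conjTranspose_mul_self A).eigenvalues_nonneg i) _
  refine ⟨?_, Real.rpow_nonneg h _⟩
  change _ = (reTr (posPow (Aᴴ * A) (p / 2)) ^ (1 / p)) ^ p
  rw [← Real.rpow_mul h, one_div, inv_mul_cancel₀ hp.ne', Real.rpow_one]

theorem signAvg_norm_sq {d N : ℕ} (x : Fin N → EuclideanSpace ℂ (Fin d)) :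
    signAvg (fun ε => ‖signSum ε x‖ ^ 2) = ∑ k, ‖x k‖ ^ 2 := by
  have h := signAvg_bilinear (fun v w : EuclideanSpace ℂ (Fin d) => (inner ℂ v w : ℂ).re)
    (fun v w z => by rw [inner_add_left, Complex.add_re])
    (fun v w z => by rw [inner_add_right, Complex.add_re]) x x
  have e : ∀ v : EuclideanSpace ℂ (Fin d), (inner ℂ v v : ℂ).re = ‖v‖ ^ 2 := fun v =>
    inner_self_eq_norm_sq (𝕜 := ℂ) v
  simpa only [e] using h

theorem signAvg_schatten_le_two {p : ℝ} (hp0 : 0 < p) (hp1 : p < 1) {n d N : ℕ}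
    (u : EuclideanSpace ℂ (Fin d) →ₗ[ℂ] Matrix (Fin n) (Fin n) ℂ)
    (hu : ∀ v : EuclideanSpace ℂ (Fin d), schattenNorm p (u v) ≤ ‖v‖)
    (x : Fin N → EuclideanSpace ℂ (Fin d)) (hx : ∑ k, ‖x k‖ ^ 2 ≤ 1) :
    signAvg (fun ε => reTr (posPow ((signSum ε fun k => u (x k))ᴴ *
      signSum ε fun k => u (x k)) (p / 2))) ≤ 2 := by
  have h : ∀ ε, reTr (posPow ((signSum ε fun k => u (x k))ᴴ *
      signSum ε fun k => u (x k)) (p / 2)) ≤ 1 + ‖signSum ε x‖ ^ 2 := by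
    intro ε
    rw [← map_signSum u ε x]
    obtain ⟨e, h0⟩ := reTr_posPow_eq_schattenNorm_rpow hp0 (u (signSum ε x))
    rw [e]
    refine (Real.rpow_le_rpow h0 (hu _) hp0.le).trans ?_
    rcases le_total ‖signSum ε x‖ 1 with h1 | h1
    · have := Real.rpow_le_one (norm_nonneg _) h1 hp0.le
      nlinarith [sq_nonneg ‖signSum ε x‖]
    · have := Real.rpow_le_rpow_of_exponent_le h1 (by push_cast; linarith : p ≤ (2 : ℕ))
      rw [Real.rpow_natCast] at this
      linarith
  refine (signAvg_mono h).trans ?_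
  rw [signAvg_add, signAvg_const, signAvg_norm_sq]
  linarith

end Factorization

/-- Core inequality of Theorem 4.3: Maurey-type factorization for operators
into Schatten `p`-classes, `0 < p < 1`. -/
theorem statement17 (p α : ℝ) (hp0 : 0 < p) (hp1 : p < 1) (hα : α = 1/p - 1/2) :
    ∃ C : ℝ, 0 < C ∧ ∀ (n d : ℕ), 1 ≤ n →
      ∀ u : EuclideanSpace ℂ (Fin d) →ₗ[ℂ] Matrix (Fin n) (Fin n) ℂ,
      (∀ v : EuclideanSpace ℂ (Fin d), schattenNorm p (u v) ≤ ‖v‖) →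
      ∀ (N : ℕ) (x : Fin N → EuclideanSpace ℂ (Fin d)),
      ∃ f : Matrix (Fin n) (Fin n) ℂ, f.PosDef ∧ f.trace = 1 ∧
        ∃ y : Fin N → Matrix (Fin n) (Fin n) ℂ,
          (∀ k, u (x k) = (1/2 : ℂ) • (posPow f α * y k + y k * posPow f α)) ∧
          ∑ k, schattenNorm 2 (y k) ^ 2 ≤ C * ∑ k, ‖x k‖ ^ 2 := by
  have hp' : 0 < 1 - p := by linarith
  obtain ⟨C, hC, hmain⟩ := exists_factorization_of_signAvg_le (s := p / (1 - p))
    (β := (1 - p) / p) hp0 (by positivity) (by field_simp) (by field_simp)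
  have hβα : (1 - p) / p + 1 / 2 = α := by
    rw [hα]
    field_simp
    ring
  rw [hβα] at hmain
  refine ⟨C, hC, fun n d hn u hu N x => ?_⟩
  set M := ∑ k, ‖x k‖ ^ 2 with hM
  have hM0 : 0 ≤ M := Finset.sum_nonneg fun k _ => sq_nonneg _
  set r := √M with hr
  have hr0 : 0 ≤ r := Real.sqrt_nonneg _
  have hr2 : r ^ 2 = M := Real.sq_sqrt hM0
  have hx : ∀ k, x k = (r : ℂ) • ((r⁻¹ : ℝ) : ℂ) • x k := by
    intro k
    rcases hr0.eq_or_lt with h | h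
    · have h0 : ∑ k, ‖x k‖ ^ 2 = 0 := by rw [← hM, ← hr2, ← h]; norm_num
      have := (Finset.sum_eq_zero_iff_of_nonneg fun k _ => sq_nonneg _).1 h0 k (Finset.mem_univ k)
      rw [norm_eq_zero.1 (pow_eq_zero_iff two_ne_zero |>.1 this), smul_zero, smul_zero]
    · rw [smul_smul, ← Complex.ofReal_mul, mul_inv_cancel₀ h.ne', Complex.ofReal_one, one_smul]
  have hle : ∑ k, ‖((r⁻¹ : ℝ) : ℂ) • x k‖ ^ 2 ≤ 1 := by
    simp only [norm_smul, mul_pow, ← Finset.mul_sum, Complex.norm_real, Real.norm_eq_abs, sq_abs]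
    rw [← hM, ← hr2, ← mul_pow]
    exact pow_le_one₀ (mul_nonneg (inv_nonneg.2 hr0) hr0) inv_mul_le_one
  obtain ⟨f, hf, hf1, y, hy, hsum⟩ := hmain n N hn _ (signAvg_schatten_le_two hp0 hp1 u hu _ hle)
  refine ⟨f, hf, by rw [trace_eq_reTr hf.1, hf1, Complex.ofReal_one],
    fun k => (r : ℂ) • y k, fun k => ?_, ?_⟩
  · conv_lhs => rw [hx k, map_smul, hy k]
    rw [Matrix.mul_smul, Matrix.smul_mul, ← smul_add, smul_comm]
  · simp only [schattenNorm_two_sq, frob_smul, Complex.norm_real, Real.norm_eq_abs, sq_abs,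
      ← Finset.mul_sum]
    rw [hr2, mul_comm]
    gcongr
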